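/- Let d ≥ 2 and c > 0. There exist constants C = C(d,c) and L₀ = L₀(d,c) such that: for every integer L ≥ L₀, every ω ∈ ℝ with ‖kω‖ > c|k|^{−2} for all integers 0 < |k| ≤ L, every B ≥ 2, every semi-algebraic set Ω ⊂ [0,1]^d of degree at most B with Lebesgue measure mes_d Ω < ε^d where ε = L^{−1/((d+1)·2^{d+1})}, and every x ∈ 𝕋^d, one has #{ n ∈ {1,…,L} : T^n x ∈ Ω } ≤ B^C ε L, where T = T_ω is the skew shift on 𝕋^d and Ω is identified with a subset of 𝕋^d. -/

import Mathlib

open MeasureTheory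

noncomputable section

/-- The circle `ℝ/ℤ`. -/
abbrev 𝕋 : Type := AddCircle (1 : ℝ)

/-- The skew shift `T_ω : 𝕋^d → 𝕋^d`: `(Tx)_i = x_i + x_{i+1}` for `i < d - 1` and
`(Tx)_{d-1} = x_{d-1} + ω` (0-indexed coordinates `i : Fin d`). -/
def skewShift (d : ℕ) (ω : ℝ) (x : Fin d → 𝕋) : Fin d → 𝕋 := fun i =>
  if h : (i : ℕ) + 1 < d then x i + x ⟨(i : ℕ) + 1, h⟩ else x i + (ω : 𝕋)

/-- The representative in `[0,1)` of a point of `𝕋`. -/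
def rep (y : 𝕋) : ℝ := ((AddCircle.equivIco 1 0) y : ℝ)

/-- A basic cell of a semi-algebraic set: the sign conditions `0, 1, 2 : Fin 3` encode
`P(x) ≤ 0`, `P(x) = 0`, `P(x) ≥ 0` respectively. -/
def SAcell {n s : ℕ} (P : Fin s → MvPolynomial (Fin n) ℝ)
    (c : Finset (Fin s) × (Fin s → Fin 3)) : Set (Fin n → ℝ) :=
  {x | ∀ l ∈ c.1,
      (c.2 l = 0 → MvPolynomial.eval x (P l) ≤ 0) ∧
      (c.2 l = 1 → MvPolynomial.eval x (P l) = 0) ∧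
      (c.2 l = 2 → 0 ≤ MvPolynomial.eval x (P l))}

/-- `S ⊆ ℝⁿ` is semi-algebraic of degree at most `B`. -/
def IsSemialgebraic (n : ℕ) (B : ℝ) (S : Set (Fin n → ℝ)) : Prop :=
  ∃ (s d₀ : ℕ) (P : Fin s → MvPolynomial (Fin n) ℝ)
    (𝒞 : Finset (Finset (Fin s) × (Fin s → Fin 3))),
      (∀ i, (P i).totalDegree ≤ d₀) ∧ ((s : ℝ) * (d₀ : ℝ) ≤ B) ∧
      S = ⋃ cc ∈ 𝒞, SAcell P cc


/-- `PolySeq m β f`: the sequence `f` in an abelian group is polynomial of degree at most `m` and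
its `m`-th difference is the constant `β`. -/
def PolySeq {A : Type*} [AddCommGroup A] : ℕ → A → (ℕ → A) → Prop
  | 0, β, f => ∀ n, f n = β
  | m + 1, β, f => ∀ h : ℕ, PolySeq m (h • β) (fun n => f (n + h) - f n)

namespace PolySeq

variable {A : Type*} [AddCommGroup A]

lemma add {m : ℕ} {β γ : A} {f g : ℕ → A} (hf : PolySeq m β f) (hg : PolySeq m γ g) :
    PolySeq m (β + γ) (fun n => f n + g n) := by
  induction m generalizing β γ f g with
  | zero => intro n; simp [hf n, hg n]
  | succ m ih =>
    intro h
    have := ih (hf h) (hg h)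
    rw [smul_add]
    convert this using 2
    rw [add_sub_add_comm]

lemma zsmul {m : ℕ} {β : A} {f : ℕ → A} (hf : PolySeq m β f) (k : ℤ) :
    PolySeq m (k • β) (fun n => k • f n) := by
  induction m generalizing β f with
  | zero => intro n; simp [hf n]
  | succ m ih =>
    intro h
    have := ih (hf h)
    rw [smul_comm]
    simpa only [smul_sub] using this

lemma sub {m : ℕ} {β γ : A} {f g : ℕ → A} (hf : PolySeq m β f) (hg : PolySeq m γ g) :
    PolySeq m (β - γ) (fun n => f n - g n) := by
  simpa [sub_eq_add_neg] using hf.add (hg.zsmul (-1))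

lemma shift {m : ℕ} {β : A} {f : ℕ → A} (hf : PolySeq m β f) (a : ℕ) :
    PolySeq m β (fun n => f (n + a)) := by
  induction m generalizing β f with
  | zero => intro n; exact hf _
  | succ m ih =>
    intro h
    have := ih (hf h)
    simpa only [add_right_comm] using this

lemma succ {m : ℕ} {β : A} {f : ℕ → A} (hf : PolySeq m β f) : PolySeq (m + 1) 0 f := by
  induction m generalizing β f with
  | zero => intro h n; simp [hf _]
  | succ m ih =>
    intro h
    simpa using ih (hf h)

lemma mono_of_lt {m m' : ℕ} (hm : m < m') {β : A} {f : ℕ → A} (hf : PolySeq m β f) :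
    PolySeq m' 0 f := by
  induction m', hm using Nat.le_induction with
  | base => exact hf.succ
  | succ k _ ih => exact ih.succ

lemma zero (m : ℕ) : PolySeq m (0 : A) (fun _ => 0) := by
  induction m with
  | zero => intro n; rfl
  | succ m ih => intro h; simpa using ih

lemma sum {ι : Type*} (s : Finset ι) {m : ℕ} {β : ι → A} {f : ι → ℕ → A}
    (hf : ∀ i ∈ s, PolySeq m (β i) (f i)) :
    PolySeq m (∑ i ∈ s, β i) (fun n => ∑ i ∈ s, f i n) := by
  classical
  induction s using Finset.induction_on with
  | empty => simpa using zero m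
  | insert a s ha ih =>
    simp only [Finset.sum_insert ha]
    exact (hf a (Finset.mem_insert_self a s)).add
      (ih fun i hi => hf i (Finset.mem_insert_of_mem hi))

lemma of_diff {m : ℕ} {β : A} {f g : ℕ → A} (hg : PolySeq m β g)
    (hfg : ∀ n, f (n + 1) = f n + g n) : PolySeq (m + 1) β f := by
  intro h
  have h1 : (fun n => f (n + h) - f n) = fun n => ∑ i ∈ Finset.range h, g (n + i) := by
    funext n
    induction h with
    | zero => simp
    | succ h ih => rw [Finset.sum_range_succ, ← ih, ← add_assoc, hfg]; abel
  rw [h1]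
  simpa using sum (Finset.range h) (β := fun _ => β) fun i _ => hg.shift i

lemma shift_sub_shift {m : ℕ} {β : A} {f : ℕ → A} (hf : PolySeq (m + 1) β f) (h h' : ℕ) :
    PolySeq m (((h : ℤ) - h') • β) (fun n => f (n + h) - f (n + h')) := by
  have := (hf h).sub (hf h')
  simpa [sub_smul] using this

end PolySeq

lemma skewShift_iterate_polySeq (d : ℕ) (ω : ℝ) (x : Fin d → 𝕋) (i : Fin d) :
    PolySeq (d - i) (ω : 𝕋) (fun n => (skewShift d ω)^[n] x i) := by
  suffices H : ∀ (j : ℕ) (i : Fin d), (i : ℕ) + (j + 1) = d →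
      PolySeq (j + 1) (ω : 𝕋) (fun n => (skewShift d ω)^[n] x i) by
    have h := H (d - (i + 1)) i (by omega)
    rwa [show d - ((i : ℕ) + 1) + 1 = d - i by omega] at h
  intro j
  induction j with
  | zero =>
    intro i hi
    refine PolySeq.of_diff (g := fun _ => (ω : 𝕋)) (fun _ => rfl) fun n => ?_
    rw [Function.iterate_succ_apply']
    have : ¬ (i : ℕ) + 1 < d := by omega
    simp [skewShift, this]
  | succ j ih =>
    intro i hi
    have h : (i : ℕ) + 1 < d := by omega
    refine PolySeq.of_diff (ih ⟨i + 1, h⟩ (by simp only; omega)) fun n => ?_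
    rw [Function.iterate_succ_apply']
    simp [skewShift, h]

/-- The standard character `y ↦ exp (2πiy)` of the circle. -/
def circleChar (y : 𝕋) : ℂ := (AddCircle.toCircle y : ℂ)

lemma circleChar_add (x y : 𝕋) : circleChar (x + y) = circleChar x * circleChar y := by
  simp [circleChar, AddCircle.toCircle_add]

lemma circleChar_sub (x y : 𝕋) :
    circleChar (x - y) = circleChar x * (starRingEnd ℂ) (circleChar y) := by
  rw [sub_eq_add_neg, circleChar_add]
  rw [circleChar, circleChar, circleChar, AddCircle.toCircle_neg, Circle.coe_inv_eq_conj]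

lemma circleChar_zero : circleChar 0 = 1 := by simp [circleChar]

lemma circleChar_nsmul (n : ℕ) (y : 𝕋) : circleChar (n • y) = circleChar y ^ n := by
  simp [circleChar, AddCircle.toCircle_nsmul]

@[simp] lemma norm_circleChar (y : 𝕋) : ‖circleChar y‖ = 1 := Circle.norm_coe _

lemma circleChar_coe (r : ℝ) :
    circleChar (r : 𝕋) = Complex.exp (Complex.I * ((2 * Real.pi * r : ℝ) : ℂ)) := by
  simp only [circleChar]
  rw [AddCircle.toCircle_apply_mk, Circle.coe_exp]
  simp [mul_comm]

lemma exists_coe_eq_abs_eq_norm (y : 𝕋) : ∃ r : ℝ, (r : 𝕋) = y ∧ |r| = ‖y‖ := by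
  obtain ⟨r, rfl⟩ := QuotientAddGroup.mk_surjective y
  refine ⟨r - round r, ?_, ?_⟩
  · have : ((round r : ℝ) : 𝕋) = 0 := by
      rw [AddCircle.coe_eq_zero_iff]
      exact ⟨round r, by simp⟩
    change ((r - round r : ℝ) : 𝕋) = (r : 𝕋)
    rw [AddCircle.coe_sub, this, sub_zero]
  · exact UnitAddCircle.norm_eq.symm

lemma four_mul_norm_le_norm_circleChar_sub_one (y : 𝕋) : 4 * ‖y‖ ≤ ‖circleChar y - 1‖ := by
  obtain ⟨r, hr, hry⟩ := exists_coe_eq_abs_eq_norm y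
  have h2 : ‖y‖ ≤ 1 / 2 := by simpa using AddCircle.norm_le_half_period (1 : ℝ) one_ne_zero (x := y)
  rw [← hr, circleChar_coe, Complex.norm_exp_I_mul_ofReal_sub_one, hr, ← hry]
  have hs := Real.mul_le_sin (x := Real.pi * |r|) (by positivity)
    (by rw [hry]; nlinarith [Real.pi_pos])
  have h3 : 2 / Real.pi * (Real.pi * |r|) = 2 * |r| := by
    field_simp
  rw [h3] at hs
  rw [show 2 * Real.pi * r / 2 = Real.pi * r by ring, norm_mul, Real.norm_eq_abs, Real.norm_eq_abs]
  have h4 : |Real.sin (Real.pi * r)| ≥ Real.sin (Real.pi * |r|) := by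
    rcases abs_cases r with ⟨h, -⟩ | ⟨h, -⟩
    · rw [h]; exact le_abs_self _
    · rw [h, mul_neg, Real.sin_neg]; exact neg_le_abs _
  norm_num
  linarith

/-- The exponential sum of length `L` with phase `f`. -/
def expSum (L : ℕ) (f : ℕ → 𝕋) : ℂ := ∑ n ∈ Finset.range L, circleChar (f n)

lemma norm_expSum_le (L : ℕ) (f : ℕ → 𝕋) : ‖expSum L f‖ ≤ L := by
  refine (norm_sum_le _ _).trans ?_
  simp

lemma PolySeq.norm_expSum_le {β : 𝕋} {f : ℕ → 𝕋} (hf : PolySeq 1 β f) (L : ℕ) :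
    2 * ‖β‖ * ‖expSum L f‖ ≤ 1 := by
  have h1 : ∀ n, f n = f 0 + n • β := fun n => by
    have := hf n 0
    simp only [zero_add] at this
    rw [← this]; abel
  have h2 : expSum L f = circleChar (f 0) * ∑ n ∈ Finset.range L, circleChar β ^ n := by
    rw [expSum, Finset.mul_sum]
    refine Finset.sum_congr rfl fun n _ => ?_
    rw [h1 n, circleChar_add, circleChar_nsmul]
  rw [h2, norm_mul, norm_circleChar, one_mul]
  have h3 : ‖∑ n ∈ Finset.range L, circleChar β ^ n‖ * ‖circleChar β - 1‖ ≤ 2 := by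
    rw [← norm_mul, geom_sum_mul]
    refine (norm_sub_le _ _).trans ?_
    simp; norm_num
  nlinarith [four_mul_norm_le_norm_circleChar_sub_one β,
    norm_nonneg (∑ n ∈ Finset.range L, circleChar β ^ n)]

lemma norm_expSum_sub_shift_le (L : ℕ) (f : ℕ → 𝕋) (h : ℕ) :
    ‖expSum L f - expSum L (fun n => f (n + h))‖ ≤ 2 * h := by
  have e1 : expSum L f + ∑ n ∈ Finset.range h, circleChar (f (L + n)) =
      ∑ n ∈ Finset.range (L + h), circleChar (f n) := (Finset.sum_range_add _ _ _).symm
  have e2 : ∑ n ∈ Finset.range h, circleChar (f n) + expSum L (fun n => f (n + h)) =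
      ∑ n ∈ Finset.range (L + h), circleChar (f n) := by
    rw [add_comm L h, Finset.sum_range_add]
    simp [expSum, add_comm]
  have e3 : expSum L f - expSum L (fun n => f (n + h)) =
      ∑ n ∈ Finset.range h, circleChar (f n) - ∑ n ∈ Finset.range h, circleChar (f (L + n)) := by
    linear_combination e1 - e2
  rw [e3]
  refine (norm_sub_le _ _).trans ?_
  have : ∀ g : ℕ → 𝕋, ‖∑ n ∈ Finset.range h, circleChar (g n)‖ ≤ h := norm_expSum_le h
  linarith [this f, this fun n => f (L + n)]

lemma sum_sq_norm_sum_circleChar_le {ι : Type*} [DecidableEq ι] (L : ℕ) (s : Finset ι)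
    (g : ι → ℕ → 𝕋) :
    ∑ n ∈ Finset.range L, ‖∑ h ∈ s, circleChar (g h n)‖ ^ 2 ≤ s.card * L +
      ∑ h ∈ s, ∑ h' ∈ s.erase h, ‖expSum L (fun n => g h n - g h' n)‖ := by
  have e2 : ((∑ n ∈ Finset.range L, ‖∑ h ∈ s, circleChar (g h n)‖ ^ 2 : ℝ) : ℂ)
      = ∑ h ∈ s, ∑ h' ∈ s, expSum L (fun n => g h n - g h' n) := by
    simp only [expSum, circleChar_sub]
    rw [Finset.sum_congr rfl fun h _ => Finset.sum_comm, Finset.sum_comm]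
    push_cast
    refine Finset.sum_congr rfl fun n _ => ?_
    rw [← Complex.mul_conj', map_sum, Finset.sum_mul_sum]
  have e3 : (∑ n ∈ Finset.range L, ‖∑ h ∈ s, circleChar (g h n)‖ ^ 2 : ℝ) =
      ‖∑ h ∈ s, ∑ h' ∈ s, expSum L (fun n => g h n - g h' n)‖ := by
    rw [← e2, Complex.norm_real, Real.norm_of_nonneg (by positivity)]
  rw [e3]
  calc _ ≤ ∑ h ∈ s, ∑ h' ∈ s, ‖expSum L (fun n => g h n - g h' n)‖ :=
        (norm_sum_le _ _).trans (Finset.sum_le_sum fun _ _ => norm_sum_le _ _)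
    _ = ∑ h ∈ s, ((L : ℝ) + ∑ h' ∈ s.erase h, ‖expSum L (fun n => g h n - g h' n)‖) := by
        refine Finset.sum_congr rfl fun h hh => ?_
        rw [← Finset.add_sum_erase _ _ hh]
        simp [expSum, circleChar_zero]
    _ = _ := by rw [Finset.sum_add_distrib]; simp

/-- Van der Corput's inequality. -/
lemma vanDerCorput (L H : ℕ) (f : ℕ → 𝕋) :
    (H : ℝ) ^ 2 * ‖expSum L f‖ ^ 2 ≤ 8 * (H : ℝ) ^ 4 + 2 * L * (H * L +
      ∑ h ∈ Finset.range H, ∑ h' ∈ (Finset.range H).erase h,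
        ‖expSum L (fun n => f (n + h) - f (n + h'))‖) := by
  set E := ∑ h ∈ Finset.range H, ∑ h' ∈ (Finset.range H).erase h,
        ‖expSum L (fun n => f (n + h) - f (n + h'))‖
  set T := ∑ n ∈ Finset.range L, ‖∑ h ∈ Finset.range H, circleChar (f (n + h))‖ with hT
  have h1 : H * ‖expSum L f‖ ≤ 2 * (H : ℝ) ^ 2 + T := by
    have e1 : (H : ℂ) * expSum L f = (∑ h ∈ Finset.range H,
        (expSum L f - expSum L (fun n => f (n + h)))) +
        ∑ n ∈ Finset.range L, ∑ h ∈ Finset.range H, circleChar (f (n + h)) := by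
      rw [Finset.sum_comm, ← Finset.sum_add_distrib]
      simp [expSum]
    calc H * ‖expSum L f‖ = ‖(H : ℂ) * expSum L f‖ := by simp
      _ ≤ ∑ h ∈ Finset.range H, (2 * H : ℝ) + T := by
          rw [e1]
          refine (norm_add_le _ _).trans <| add_le_add
            ((norm_sum_le _ _).trans (Finset.sum_le_sum fun h hh => ?_))
            (norm_sum_le _ _)
          refine (norm_expSum_sub_shift_le _ _ _).trans ?_
          have : (h : ℝ) ≤ H := by exact_mod_cast (Finset.mem_range.1 hh).le
          linarith
      _ = _ := by simp; ring
  have h2 : T ^ 2 ≤ L * (H * L + E) := by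
    have hcs := sq_sum_le_card_mul_sum_sq (s := Finset.range L)
      (f := fun n => ‖∑ h ∈ Finset.range H, circleChar (f (n + h))‖)
    rw [Finset.card_range] at hcs
    refine hcs.trans (mul_le_mul_of_nonneg_left ?_ (by positivity))
    simpa using sum_sq_norm_sum_circleChar_le L (Finset.range H) fun h n => f (n + h)
  have hT0 : 0 ≤ T := by positivity
  have h3 : (H * ‖expSum L f‖) ^ 2 ≤ (2 * (H : ℝ) ^ 2 + T) ^ 2 :=
    pow_le_pow_left₀ (by positivity) h1 2
  nlinarith [sq_nonneg (2 * (H : ℝ) ^ 2 - T)]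

lemma norm_coe_le_abs (r : ℝ) : ‖(r : 𝕋)‖ ≤ |r| := by
  rw [UnitAddCircle.norm_eq]
  simpa using round_le r 0

lemma sum_inv_norm_le_of_separated {ι : Type*} [DecidableEq ι] (A : Finset ι) (x : ι → 𝕋) {δ : ℝ}
    (hδ : 0 < δ) (hδ1 : δ ≤ 1) (h0 : ∀ a ∈ A, δ ≤ ‖x a‖)
    (hsep : ∀ a ∈ A, ∀ b ∈ A, a ≠ b → δ ≤ ‖x a - x b‖) :
    ∑ a ∈ A, ‖x a‖⁻¹ ≤ 2 * δ⁻¹ * (1 + Real.log δ⁻¹) := by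
  choose r hr hrn using exists_coe_eq_abs_eq_norm
  set J := ⌊δ⁻¹⌋₊ with hJ
  have hJ1 : 1 ≤ J := Nat.one_le_floor_iff _ |>.2 ((one_le_inv₀ hδ).2 hδ1)
  set g : ι → ℕ := fun a => ⌊‖x a‖ / δ⌋₊ with hg
  have hg1 : ∀ a ∈ A, 1 ≤ g a := fun a ha =>
    (Nat.one_le_floor_iff _).2 ((one_le_div hδ).2 (h0 a ha))
  have hlow : ∀ a, g a * δ ≤ ‖x a‖ := fun a => by
    have := Nat.floor_le (a := ‖x a‖ / δ) (by positivity)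
    rwa [le_div_iff₀ hδ] at this
  have hup : ∀ a, ‖x a‖ < (g a + 1) * δ := fun a => by
    have := Nat.lt_floor_add_one (‖x a‖ / δ)
    rwa [div_lt_iff₀ hδ] at this
  have hmaps : ∀ a ∈ A, g a ∈ Finset.Icc 1 J := fun a ha => by
    refine Finset.mem_Icc.2 ⟨hg1 a ha, Nat.floor_le_floor ?_⟩
    rw [div_eq_mul_inv]
    have h2 : ‖x a‖ ≤ 1 / 2 := by
      simpa using AddCircle.norm_le_half_period (1 : ℝ) one_ne_zero (x := x a)
    nlinarith [inv_pos.2 hδ]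
  have hfib : ∀ j, (A.filter fun a => g a = j).card ≤ 2 := fun j => by
    rw [← Fintype.card_bool, ← Finset.card_univ]
    refine Finset.card_le_card_of_injOn (fun a => decide (0 ≤ r (x a)))
      (fun _ _ => Finset.mem_coe.2 (Finset.mem_univ _)) ?_
    intro a ha b hb hab
    simp only [Finset.coe_filter, Set.mem_ofPred_eq] at ha hb
    by_contra hne
    have h1 := hsep a ha.1 b hb.1 hne
    have h2 : ‖x a - x b‖ ≤ |r (x a) - r (x b)| := by
      conv_lhs => rw [← hr (x a), ← hr (x b), ← AddCircle.coe_sub]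
      exact norm_coe_le_abs _
    have la := hlow a
    have ua := hup a
    have lb := hlow b
    have ub := hup b
    rw [ha.2, ← hrn] at la ua
    rw [hb.2, ← hrn] at lb ub
    have h3 : |r (x a) - r (x b)| < δ := by
      by_cases hs : 0 ≤ r (x a)
      · have hs' : 0 ≤ r (x b) := by simpa [hs] using hab
        rw [abs_of_nonneg hs] at la ua
        rw [abs_of_nonneg hs'] at lb ub
        rw [abs_lt]; constructor <;> linarith
      · have hs' : ¬ 0 ≤ r (x b) := by simpa [hs] using hab
        rw [abs_of_neg (not_le.1 hs)] at la ua
        rw [abs_of_neg (not_le.1 hs')] at lb ub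
        rw [abs_lt]; constructor <;> linarith
    linarith
  calc ∑ a ∈ A, ‖x a‖⁻¹ ≤ ∑ a ∈ A, δ⁻¹ * (g a : ℝ)⁻¹ := by
        refine Finset.sum_le_sum fun a ha => ?_
        rw [← mul_inv, mul_comm]
        have : (0 : ℝ) < g a := by exact_mod_cast hg1 a ha
        exact inv_anti₀ (by positivity) (hlow a)
    _ = ∑ j ∈ Finset.Icc 1 J, ∑ a ∈ A with g a = j, δ⁻¹ * (g a : ℝ)⁻¹ :=
        (Finset.sum_fiberwise_of_maps_to hmaps _).symm
    _ ≤ ∑ j ∈ Finset.Icc 1 J, 2 * (δ⁻¹ * (j : ℝ)⁻¹) := by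
        refine Finset.sum_le_sum fun j _ => ?_
        rw [Finset.sum_congr rfl (g := fun _ => δ⁻¹ * (j : ℝ)⁻¹) fun a ha => by
          rw [(Finset.mem_filter.1 ha).2]]
        rw [Finset.sum_const, nsmul_eq_mul]
        refine mul_le_mul_of_nonneg_right ?_ (by positivity)
        exact_mod_cast hfib j
    _ = 2 * δ⁻¹ * (harmonic J : ℝ) := by
        rw [harmonic_eq_sum_Icc]
        push_cast
        rw [Finset.mul_sum]
        exact Finset.sum_congr rfl fun _ _ => by ring
    _ ≤ 2 * δ⁻¹ * (1 + Real.log δ⁻¹) := by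
        refine mul_le_mul_of_nonneg_left ((harmonic_le_one_add_log J).trans ?_) (by positivity)
        refine add_le_add le_rfl (Real.log_le_log (by exact_mod_cast hJ1) ?_)
        exact Nat.floor_le (by positivity)

lemma norm_expSum_le_of_correlations {L : ℕ} (hL : 1 ≤ L) {τ M : ℝ} (hτ0 : 0 ≤ τ) (hτ : 4 * τ ≤ 1)
    (hM : 0 ≤ M) (f : ℕ → 𝕋)
    (hE : ∑ h ∈ Finset.range ⌈(L : ℝ) ^ (2 * τ)⌉₊,
      ∑ h' ∈ (Finset.range ⌈(L : ℝ) ^ (2 * τ)⌉₊).erase h,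
        ‖expSum L (fun n => f (n + h) - f (n + h'))‖ ≤
      M * (⌈(L : ℝ) ^ (2 * τ)⌉₊ * L + (⌈(L : ℝ) ^ (2 * τ)⌉₊ : ℝ) ^ 2 * (L : ℝ) ^ (1 - 2 * τ))) :
    ‖expSum L f‖ ≤ (34 + 4 * M) * (L : ℝ) ^ (1 - τ) := by
  have hL' : (1 : ℝ) ≤ L := by exact_mod_cast hL
  have hL0 : (0 : ℝ) < L := by linarith
  have hv := vanDerCorput L ⌈(L : ℝ) ^ (2 * τ)⌉₊ f
  have hu1 : 1 ≤ (L : ℝ) ^ (2 * τ) := Real.one_le_rpow hL' (by linarith)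
  have hHu : (L : ℝ) ^ (2 * τ) ≤ (⌈(L : ℝ) ^ (2 * τ)⌉₊ : ℝ) := Nat.le_ceil _
  have hHu2 : (⌈(L : ℝ) ^ (2 * τ)⌉₊ : ℝ) ≤ 2 * (L : ℝ) ^ (2 * τ) := by
    have := Nat.ceil_lt_add_one (a := (L : ℝ) ^ (2 * τ)) (by linarith)
    linarith
  have e1 : (L : ℝ) ^ (2 * τ) * (L : ℝ) ^ (1 - 2 * τ) = L := by
    rw [← Real.rpow_add hL0]; simp
  have e2 : (L : ℝ) ^ (2 * τ) * ((L : ℝ) ^ (1 - τ)) ^ 2 = (L : ℝ) ^ 2 := by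
    rw [← Real.rpow_natCast, ← Real.rpow_natCast, ← Real.rpow_mul hL0.le, ← Real.rpow_add hL0]
    congr 1; push_cast; ring
  have e3 : ((L : ℝ) ^ (2 * τ)) ≤ (L : ℝ) ^ (1 - τ) :=
    Real.rpow_le_rpow_of_exponent_le hL' (by linarith)
  have e4 : (L : ℝ) * (L : ℝ) ^ (1 - 2 * τ) = ((L : ℝ) ^ (1 - τ)) ^ 2 := by
    rw [← Real.rpow_natCast, ← Real.rpow_mul hL0.le]
    nth_rewrite 1 [← Real.rpow_one (L : ℝ)]
    rw [← Real.rpow_add hL0]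
    congr 1; push_cast; ring
  generalize (⌈(L : ℝ) ^ (2 * τ)⌉₊ : ℕ) = H at *
  generalize (L : ℝ) ^ (2 * τ) = u at *
  generalize (L : ℝ) ^ (1 - 2 * τ) = w at *
  have hv0 : 0 ≤ (L : ℝ) ^ (1 - τ) := by positivity
  generalize (L : ℝ) ^ (1 - τ) = v at *
  have hH0 : (0 : ℝ) < H := by linarith
  have hS0 := norm_nonneg (expSum L f)
  generalize ‖expSum L f‖ = S at *
  have t1 : (H : ℝ) ^ 2 ≤ 4 * v ^ 2 := by nlinarith
  have t2 : (L : ℝ) ^ 2 * H ≤ v ^ 2 * H ^ 2 := by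
    rw [← e2]
    have : u * v ^ 2 * H ≤ H * v ^ 2 * H := by gcongr
    linarith
  have key : (H : ℝ) ^ 2 * S ^ 2 ≤ H ^ 2 * ((34 + 4 * M) * v ^ 2) := by
    calc (H : ℝ) ^ 2 * S ^ 2 ≤ 8 * (H : ℝ) ^ 2 * H ^ 2 + 2 * L *
          (H * L + M * (H * L + (H : ℝ) ^ 2 * w)) := by
          refine hv.trans ?_
          have : 8 * (H : ℝ) ^ 4 = 8 * (H : ℝ) ^ 2 * H ^ 2 := by ring
          rw [this]
          gcongr
      _ = 8 * (H : ℝ) ^ 2 * H ^ 2 + (2 + 2 * M) * ((L : ℝ) ^ 2 * H) +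
          2 * M * H ^ 2 * (L * w) := by ring
      _ ≤ 8 * (4 * v ^ 2) * H ^ 2 + (2 + 2 * M) * (v ^ 2 * H ^ 2) + 2 * M * H ^ 2 * v ^ 2 := by
          rw [e4]
          gcongr
      _ = _ := by ring
  have key2 : S ^ 2 ≤ (34 + 4 * M) * v ^ 2 := le_of_mul_le_mul_left key (by positivity)
  refine abs_le_of_sq_le_sq' ?_ (by positivity) |>.2
  have : (34 + 4 * M) * v ^ 2 ≤ (34 + 4 * M) ^ 2 * v ^ 2 := by
    refine mul_le_mul_of_nonneg_right ?_ (by positivity)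
    nlinarith
  rw [mul_pow]
  linarith

/-- The Diophantine condition `‖kω‖ > c|k|⁻²` for `0 < |k| ≤ L`. -/
def DiophantineUpTo (c : ℝ) (L : ℕ) (ω : ℝ) : Prop :=
  ∀ k : ℤ, k ≠ 0 → |k| ≤ (L : ℤ) → c / (k : ℝ) ^ 2 < ‖((k * ω : ℝ) : 𝕋)‖

lemma DiophantineUpTo.le_norm_zsmul {c ω : ℝ} {L : ℕ} (hc : 0 < c) (hω : DiophantineUpTo c L ω)
    (hL : 1 ≤ L) {κ : ℝ} (hκ : κ ≤ 1) {k : ℤ} (hk : k ≠ 0) (hkL : |(k : ℝ)| ≤ (L : ℝ) ^ κ) :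
    c * ((L : ℝ) ^ (2 * κ))⁻¹ ≤ ‖k • (ω : 𝕋)‖ := by
  have hL' : (1 : ℝ) ≤ L := by exact_mod_cast hL
  have hL0 : (0 : ℝ) < L := by linarith
  have h1 : |k| ≤ (L : ℤ) := by
    have : |(k : ℝ)| ≤ L := hkL.trans (Real.rpow_le_self_of_one_le hL' hκ)
    exact_mod_cast this
  have h2 := (hω k hk h1).le
  have h3 : ((k * ω : ℝ) : 𝕋) = k • (ω : 𝕋) := by
    rw [← AddCircle.coe_zsmul, zsmul_eq_mul]
  rw [h3] at h2
  refine le_trans ?_ h2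
  rw [div_eq_mul_inv]
  have hk0 : (0 : ℝ) < |(k : ℝ)| := by simpa using hk
  refine mul_le_mul_of_nonneg_left (inv_anti₀ (by rw [← sq_abs]; positivity) ?_) hc.le
  rw [← sq_abs, show 2 * κ = κ * (2 : ℕ) by push_cast; ring, Real.rpow_mul hL0.le,
    Real.rpow_natCast]
  gcongr

lemma abs_sub_mul_le {L : ℕ} (hL : 1 ≤ L) {τ κ : ℝ} {h h' : ℕ}
    (hh : h < ⌈(L : ℝ) ^ (2 * τ)⌉₊) (hh' : h' < ⌈(L : ℝ) ^ (2 * τ)⌉₊) {k : ℤ}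
    (hk : |(k : ℝ)| ≤ (L : ℝ) ^ κ) :
    |((((h : ℤ) - h') * k : ℤ) : ℝ)| ≤ (L : ℝ) ^ (κ + 2 * τ) := by
  have hL0 : (0 : ℝ) < L := by exact_mod_cast hL
  rw [Nat.lt_ceil] at hh hh'
  push_cast
  rw [abs_mul, add_comm, Real.rpow_add hL0]
  have : |(h : ℝ) - h'| ≤ (L : ℝ) ^ (2 * τ) := by
    rw [abs_le]
    constructor <;> linarith [Nat.cast_nonneg (α := ℝ) h, Nat.cast_nonneg (α := ℝ) h']
  gcongr

lemma sum_norm_expSum_le_of_quadratic {c η : ℝ} (hc : 0 < c) (hc1 : c ≤ 1) (hη : 0 < η)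
    {L : ℕ} (hL : 1 ≤ L) {τ κ : ℝ} (hτ : 0 ≤ τ) (hκ : 0 ≤ κ) (hκτ : 2 * κ + 4 * τ ≤ 1 - η)
    {ω : ℝ} (hω : DiophantineUpTo c L ω) {k : ℤ} (hk : k ≠ 0) (hkL : |(k : ℝ)| ≤ (L : ℝ) ^ κ)
    {f : ℕ → 𝕋} (hf : PolySeq 2 (k • (ω : 𝕋)) f) {h : ℕ}
    (hh : h ∈ Finset.range ⌈(L : ℝ) ^ (2 * τ)⌉₊) :
    ∑ h' ∈ (Finset.range ⌈(L : ℝ) ^ (2 * τ)⌉₊).erase h,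
        ‖expSum L (fun n => f (n + h) - f (n + h'))‖ ≤ (1 + 1 / η) * (c⁻¹) ^ (1 + η) * L := by
  have hL' : (1 : ℝ) ≤ L := by exact_mod_cast hL
  have hL0 : (0 : ℝ) < L := by linarith
  set δ : ℝ := c * ((L : ℝ) ^ (2 * (κ + 2 * τ)))⁻¹ with hδ
  have hδ0 : 0 < δ := by positivity
  have hpow1 : 1 ≤ (L : ℝ) ^ (2 * (κ + 2 * τ)) := Real.one_le_rpow hL' (by linarith)
  have hδ1 : δ ≤ 1 := mul_le_one₀ hc1 (by positivity) (inv_le_one_of_one_le₀ hpow1)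
  have hlow : ∀ a ∈ Finset.range ⌈(L : ℝ) ^ (2 * τ)⌉₊, ∀ b ∈ Finset.range ⌈(L : ℝ) ^ (2 * τ)⌉₊,
      a ≠ b → δ ≤ ‖((a : ℤ) - b) • k • (ω : 𝕋)‖ := fun a ha b hb hab => by
    rw [smul_smul]
    refine hω.le_norm_zsmul hc hL (by linarith) (mul_ne_zero ?_ hk)
      (abs_sub_mul_le hL (Finset.mem_range.1 ha) (Finset.mem_range.1 hb) hkL)
    rw [sub_ne_zero]; exact_mod_cast hab
  have hsum := sum_inv_norm_le_of_separated ((Finset.range ⌈(L : ℝ) ^ (2 * τ)⌉₊).erase h)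
    (fun h' : ℕ => ((h : ℤ) - h') • k • (ω : 𝕋)) hδ0 hδ1
    (fun a ha => hlow h hh a (Finset.mem_of_mem_erase ha) (Finset.ne_of_mem_erase ha).symm)
    (fun a ha b hb hab => by
      rw [← sub_smul, sub_sub_sub_cancel_left]
      exact hlow b (Finset.mem_of_mem_erase hb) a (Finset.mem_of_mem_erase ha) hab.symm)
  have h1 : ∑ h' ∈ (Finset.range ⌈(L : ℝ) ^ (2 * τ)⌉₊).erase h,
        ‖expSum L (fun n => f (n + h) - f (n + h'))‖ ≤
      (1 / 2) * ∑ h' ∈ (Finset.range ⌈(L : ℝ) ^ (2 * τ)⌉₊).erase h,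
        ‖((h : ℤ) - h') • k • (ω : 𝕋)‖⁻¹ := by
    rw [Finset.mul_sum]
    refine Finset.sum_le_sum fun a ha => ?_
    have hpos := hδ0.trans_le
      (hlow h hh a (Finset.mem_of_mem_erase ha) (Finset.ne_of_mem_erase ha).symm)
    have := (hf.shift_sub_shift h a).norm_expSum_le L
    rw [← div_eq_mul_inv, le_div_iff₀ hpos]
    linarith
  refine h1.trans ?_
  have hδi : 1 ≤ δ⁻¹ := (one_le_inv₀ hδ0).2 hδ1
  have hlog : Real.log δ⁻¹ ≤ δ⁻¹ ^ η / η := Real.log_le_rpow_div (by linarith) hη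
  have hone : 1 ≤ δ⁻¹ ^ η := Real.one_le_rpow hδi hη.le
  have h2 : δ⁻¹ * (1 + Real.log δ⁻¹) ≤ (1 + 1 / η) * δ⁻¹ ^ (1 + η) := by
    rw [Real.rpow_add (by linarith), Real.rpow_one]
    calc δ⁻¹ * (1 + Real.log δ⁻¹) ≤ δ⁻¹ * (δ⁻¹ ^ η + δ⁻¹ ^ η / η) := by gcongr
      _ = _ := by ring
  have h3 : δ⁻¹ ^ (1 + η) ≤ (c⁻¹) ^ (1 + η) * L := by
    rw [hδ, mul_inv, inv_inv, Real.mul_rpow (by positivity) (by positivity)]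
    refine mul_le_mul_of_nonneg_left ?_ (by positivity)
    rw [← Real.rpow_mul hL0.le]
    refine Real.rpow_le_self_of_one_le hL' ?_
    nlinarith
  calc _ ≤ 1 / 2 * (2 * δ⁻¹ * (1 + Real.log δ⁻¹)) := by gcongr
    _ = δ⁻¹ * (1 + Real.log δ⁻¹) := by ring
    _ ≤ _ := h2
    _ ≤ (1 + 1 / η) * ((c⁻¹) ^ (1 + η) * L) := by gcongr
    _ = _ := by ring

lemma weyl_bound_of_two_le {c η : ℝ} (hc : 0 < c) (hc1 : c ≤ 1) (hη : 0 < η) (r : ℕ) (hr : 2 ≤ r) :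
    ∃ C : ℝ, 0 ≤ C ∧ ∀ L : ℕ, 1 ≤ L → ∀ τ κ : ℝ, 0 ≤ τ → 0 ≤ κ →
      2 * κ + (2 ^ (r + 1) - 4) * τ ≤ 1 - η → ∀ ω : ℝ, DiophantineUpTo c L ω →
      ∀ k : ℤ, k ≠ 0 → |(k : ℝ)| ≤ (L : ℝ) ^ κ → ∀ f : ℕ → 𝕋, PolySeq r (k • (ω : 𝕋)) f →
      ‖expSum L f‖ ≤ C * (L : ℝ) ^ (1 - τ) := by
  induction r, hr using Nat.le_induction with
  | base =>
    refine ⟨34 + 4 * ((1 + 1 / η) * (c⁻¹) ^ (1 + η)), by positivity, ?_⟩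
    intro L hL τ κ hτ hκ hκτ ω hω k hk hkL f hf
    norm_num at hκτ
    refine norm_expSum_le_of_correlations hL hτ (by linarith) (by positivity) f ?_
    calc _ ≤ ∑ h ∈ Finset.range ⌈(L : ℝ) ^ (2 * τ)⌉₊, (1 + 1 / η) * (c⁻¹) ^ (1 + η) * L :=
          Finset.sum_le_sum fun h hh =>
            sum_norm_expSum_le_of_quadratic hc hc1 hη hL hτ hκ hκτ hω hk hkL hf hh
      _ = (1 + 1 / η) * (c⁻¹) ^ (1 + η) * (⌈(L : ℝ) ^ (2 * τ)⌉₊ * L) := by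
          rw [Finset.sum_const, Finset.card_range, nsmul_eq_mul]; ring
      _ ≤ _ := by
          refine mul_le_mul_of_nonneg_left ?_ (by positivity)
          exact le_add_of_nonneg_right (by positivity)
  | succ r hr ih =>
    obtain ⟨C, hC, ih⟩ := ih
    refine ⟨34 + 4 * C, by positivity, ?_⟩
    intro L hL τ κ hτ hκ hκτ ω hω k hk hkL f hf
    have hpow : (8 : ℝ) ≤ 2 ^ (r + 1) := by
      calc (8 : ℝ) = 2 ^ 3 := by norm_num
        _ ≤ _ := pow_le_pow_right₀ (by norm_num) (by omega)
    have hpow2 : (2 : ℝ) ^ (r + 1 + 1) = 2 * 2 ^ (r + 1) := by ring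
    have hτ4 : 4 * τ ≤ 1 := by nlinarith
    refine norm_expSum_le_of_correlations hL hτ hτ4 hC f ?_
    calc _ ≤ ∑ h ∈ Finset.range ⌈(L : ℝ) ^ (2 * τ)⌉₊,
          ∑ h' ∈ Finset.range ⌈(L : ℝ) ^ (2 * τ)⌉₊, C * (L : ℝ) ^ (1 - 2 * τ) := by
          refine Finset.sum_le_sum fun h hh => ?_
          refine (Finset.sum_le_sum (g := fun _ => C * (L : ℝ) ^ (1 - 2 * τ)) fun h' hh' => ?_).trans
            (Finset.sum_le_sum_of_subset_of_nonneg (Finset.erase_subset _ _)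
              fun _ _ _ => by positivity)
          refine ih L hL (2 * τ) (κ + 2 * τ) (by positivity) (by positivity) (by nlinarith) ω hω
            (((h : ℤ) - h') * k) (mul_ne_zero ?_ hk) (abs_sub_mul_le hL (Finset.mem_range.1 hh)
              (Finset.mem_range.1 (Finset.mem_of_mem_erase hh')) hkL) _ ?_
          · rw [sub_ne_zero]
            exact_mod_cast (Finset.ne_of_mem_erase hh').symm
          · rw [mul_smul]
            exact hf.shift_sub_shift h h'
      _ = C * ((⌈(L : ℝ) ^ (2 * τ)⌉₊ : ℝ) ^ 2 * (L : ℝ) ^ (1 - 2 * τ)) := by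
          simp only [Finset.sum_const, Finset.card_range, nsmul_eq_mul]; ring
      _ ≤ _ := by
          refine mul_le_mul_of_nonneg_left ?_ hC
          exact le_add_of_nonneg_left (by positivity)

lemma weyl_bound {c η : ℝ} (hc : 0 < c) (hc1 : c ≤ 1) (hη : 0 < η) (r : ℕ) (hr : 1 ≤ r) :
    ∃ C : ℝ, 0 ≤ C ∧ ∀ L : ℕ, 1 ≤ L → ∀ τ κ : ℝ, 0 ≤ τ → 0 ≤ κ →
      2 * κ + (2 ^ (r + 1) - 4) * τ ≤ 1 - η → 2 * κ + τ ≤ 1 → ∀ ω : ℝ, DiophantineUpTo c L ω →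
      ∀ k : ℤ, k ≠ 0 → |(k : ℝ)| ≤ (L : ℝ) ^ κ → ∀ f : ℕ → 𝕋, PolySeq r (k • (ω : 𝕋)) f →
      ‖expSum L f‖ ≤ C * (L : ℝ) ^ (1 - τ) := by
  rcases hr.eq_or_lt with rfl | hr
  · refine ⟨c⁻¹, by positivity, ?_⟩
    intro L hL τ κ hτ hκ _ hκτ ω hω k hk hkL f hf
    have hL' : (1 : ℝ) ≤ L := by exact_mod_cast hL
    have h1 := hω.le_norm_zsmul hc hL (by linarith) hk hkL
    have h2 := hf.norm_expSum_le L
    have h3 : (L : ℝ) ^ (2 * κ) ≤ (L : ℝ) ^ (1 - τ) :=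
      Real.rpow_le_rpow_of_exponent_le hL' (by linarith)
    have hp : 0 < (L : ℝ) ^ (2 * κ) := by positivity
    refine le_trans ?_ (mul_le_mul_of_nonneg_left h3 (by positivity))
    have h4 : c * ((L : ℝ) ^ (2 * κ))⁻¹ * ‖expSum L f‖ ≤ 1 := by
      nlinarith [norm_nonneg (expSum L f), norm_nonneg (k • (ω : 𝕋))]
    calc ‖expSum L f‖ = c⁻¹ * (L : ℝ) ^ (2 * κ) *
          (c * ((L : ℝ) ^ (2 * κ))⁻¹ * ‖expSum L f‖) := by field_simp
      _ ≤ c⁻¹ * (L : ℝ) ^ (2 * κ) * 1 := by gcongr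
      _ = _ := mul_one _
  · obtain ⟨C, hC, H⟩ := weyl_bound_of_two_le hc hc1 hη r hr
    exact ⟨C, hC, fun L hL τ κ hτ hκ h1 _ => H L hL τ κ hτ hκ h1⟩

lemma half_mul_le_norm_sum_circleChar (K : ℕ) (t : 𝕋) (ht : ∀ j < K, 6 * j * ‖t‖ ≤ 1) :
    (K : ℝ) / 2 ≤ ‖∑ j ∈ Finset.range K, circleChar (j • t)‖ := by
  refine le_trans ?_ (Complex.re_le_norm _)
  rw [Complex.re_sum]
  have : ∀ j ∈ Finset.range K, (1 / 2 : ℝ) ≤ (circleChar (j • t)).re := fun j hj => by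
    obtain ⟨r, hr, hrt⟩ := exists_coe_eq_abs_eq_norm t
    have h1 := ht j (Finset.mem_range.1 hj)
    rw [← hr, ← AddCircle.coe_nsmul, circleChar_coe, mul_comm Complex.I, Complex.exp_ofReal_mul_I_re,
      ← Real.cos_abs, ← Real.cos_pi_div_three, nsmul_eq_mul, abs_mul, abs_mul (j : ℝ), hrt, Nat.abs_cast,
      abs_of_pos Real.two_pi_pos]
    refine Real.cos_le_cos_of_nonneg_of_le_pi (by positivity) (by linarith [Real.pi_pos]) ?_
    nlinarith [Real.pi_pos]
  refine le_trans ?_ (Finset.sum_le_sum this)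
  simp [div_eq_mul_inv]

lemma card_filter_near_le {ι : Type*} [Fintype ι] [DecidableEq ι] {L K : ℕ} (hK : 1 ≤ K)
    (y : ℕ → ι → 𝕋) (a : ι → 𝕋) {M : ℝ} (hM0 : 0 ≤ M)
    (hM : ∀ k : ι → ℤ, k ≠ 0 → (∀ i, |k i| < K) →
      ‖expSum L (fun n => ∑ i, k i • y n i)‖ ≤ M)
    (S : Finset ℕ) (hSL : S ⊆ Finset.range L)
    (hS : ∀ n ∈ S, ∀ i, ∀ j < K, 6 * j * ‖y n i - a i‖ ≤ 1) :
    (S.card : ℝ) ≤ 4 ^ Fintype.card ι * (L / (K : ℝ) ^ Fintype.card ι + M) := by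
  set d := Fintype.card ι
  set s : Finset (ι → ℕ) := Fintype.piFinset fun _ => Finset.range K with hs
  have hcard : s.card = K ^ d := by simp [hs, d]
  have hK0 : (0 : ℝ) < K := by exact_mod_cast hK
  have hprod : ∀ t : ι → 𝕋, ∏ i, ∑ j ∈ Finset.range K, circleChar (j • t i) =
      ∑ J ∈ s, circleChar (∑ i, J i • t i) := fun t => by
    rw [Finset.prod_univ_sum]
    refine Finset.sum_congr rfl fun J _ => ?_
    have : ∀ (u : Finset ι) (g : ι → 𝕋), circleChar (∑ i ∈ u, g i) = ∏ i ∈ u, circleChar (g i) := by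
      intro u g
      induction u using Finset.induction_on with
      | empty => simp [circleChar_zero]
      | insert b u hb ih => rw [Finset.sum_insert hb, Finset.prod_insert hb, circleChar_add, ih]
    rw [this]
  have h1 : (S.card : ℝ) * ((K : ℝ) / 2) ^ (2 * d) ≤
      ∑ n ∈ Finset.range L, ‖∑ J ∈ s, circleChar (∑ i, J i • (y n i - a i))‖ ^ 2 := by
    rw [← nsmul_eq_mul, ← Finset.sum_const]
    refine (Finset.sum_le_sum fun n hn => ?_).trans
      (Finset.sum_le_sum_of_subset_of_nonneg hSL fun _ _ _ => by positivity)
    rw [← hprod, norm_prod, mul_comm 2 d, pow_mul]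
    refine pow_le_pow_left₀ (by positivity) ?_ 2
    have h3 := Finset.prod_le_prod (s := Finset.univ) (f := fun _ : ι => (K : ℝ) / 2)
      (fun _ _ => by positivity)
      fun i _ => half_mul_le_norm_sum_circleChar K (y n i - a i) (hS n hn i)
    rwa [Finset.prod_const, Finset.card_univ] at h3
  have h2 := sum_sq_norm_sum_circleChar_le L s fun J n => ∑ i, J i • (y n i - a i)
  have h3 : ∀ J ∈ s, ∀ J' ∈ s.erase J,
      ‖expSum L (fun n => ∑ i, J i • (y n i - a i) - ∑ i, J' i • (y n i - a i))‖ ≤ M := by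
    intro J hJ J' hJ'
    have hJ'' := Finset.mem_of_mem_erase hJ'
    simp only [hs, Fintype.mem_piFinset, Finset.mem_range] at hJ hJ''
    set k : ι → ℤ := fun i => (J i : ℤ) - J' i with hk
    have hk0 : k ≠ 0 := fun h => Finset.ne_of_mem_erase hJ' <| funext fun i => by
      have := congrFun h i
      simp only [hk, Pi.zero_apply] at this
      omega
    have e : expSum L (fun n => ∑ i, J i • (y n i - a i) - ∑ i, J' i • (y n i - a i)) =
        circleChar (-∑ i, k i • a i) * expSum L (fun n => ∑ i, k i • y n i) := by
      rw [expSum, expSum, Finset.mul_sum]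
      refine Finset.sum_congr rfl fun n _ => ?_
      rw [← circleChar_add]
      congr 1
      rw [← Finset.sum_sub_distrib, ← Finset.sum_neg_distrib, ← Finset.sum_add_distrib]
      refine Finset.sum_congr rfl fun i _ => ?_
      simp only [hk, sub_smul, natCast_zsmul, smul_sub]
      abel
    rw [e, norm_mul, norm_circleChar, one_mul]
    refine hM k hk0 fun i => ?_
    have := hJ i
    have := hJ'' i
    simp only [hk]
    rw [abs_lt]
    omega
  have h4 : (S.card : ℝ) * ((K : ℝ) / 2) ^ (2 * d) ≤
      (K : ℝ) ^ d * L + (K : ℝ) ^ d * ((K : ℝ) ^ d * M) := by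
    refine h1.trans (h2.trans ?_)
    rw [hcard]
    push_cast
    refine add_le_add le_rfl ?_
    calc _ ≤ ∑ J ∈ s, ∑ J' ∈ s, M := by
          refine Finset.sum_le_sum fun J hJ => (Finset.sum_le_sum (h3 J hJ)).trans ?_
          exact Finset.sum_le_sum_of_subset_of_nonneg (Finset.erase_subset _ _) fun _ _ _ => hM0
      _ = _ := by simp [hcard]
  have h5 : ((K : ℝ) / 2) ^ (2 * d) = (K : ℝ) ^ d * K ^ d / 4 ^ d := by
    rw [div_pow, pow_mul 2, show (2 : ℝ) ^ 2 = 4 by norm_num]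
    ring
  rw [h5] at h4
  have hKd : (0 : ℝ) < (K : ℝ) ^ d := by positivity
  have h6 : (S.card : ℝ) * ((K : ℝ) ^ d * K ^ d / 4 ^ d) ≤
      4 ^ d * (L / (K : ℝ) ^ d + M) * ((K : ℝ) ^ d * K ^ d / 4 ^ d) := by
    refine h4.trans_eq ?_
    field_simp
  exact le_of_mul_le_mul_right h6 (by positivity)

lemma exists_norm_expSum_skewShift_le (d : ℕ) (hd : 1 ≤ d) {c : ℝ} (hc : 0 < c) :
    ∃ C : ℝ, 0 ≤ C ∧ ∀ L : ℕ, 1 ≤ L → ∀ ω : ℝ, DiophantineUpTo c L ω → ∀ x : Fin d → 𝕋,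
      ∀ k : Fin d → ℤ, k ≠ 0 →
      (∀ i, |(k i : ℝ)| ≤ (L : ℝ) ^ (1 / (((d : ℝ) + 1) * 2 ^ (d + 1)))) →
      ‖expSum L (fun n => ∑ i, k i • (skewShift d ω)^[n + 1] x i)‖ ≤
        C * (L : ℝ) ^ (1 - d / (((d : ℝ) + 1) * 2 ^ (d + 1))) := by
  have hη : (0 : ℝ) < 1 / (d + 1) := by positivity
  choose! C hC0 hC using fun r => weyl_bound (lt_min hc one_pos) (min_le_right c 1) hη r
  refine ⟨∑ r ∈ Finset.Icc 1 d, C r,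
    Finset.sum_nonneg fun r hr => hC0 r (Finset.mem_Icc.1 hr).1, ?_⟩
  intro L hL ω hω x k hk hkL
  have hω' : DiophantineUpTo (min c 1) L ω := fun k hk0 hkl =>
    (div_le_div_of_nonneg_right (min_le_left c 1) (sq_nonneg _)).trans_lt (hω k hk0 hkl)
  obtain ⟨j, hj, hjmin⟩ : ∃ j, k j ≠ 0 ∧ ∀ i < j, k i = 0 := by
    obtain ⟨i, hi⟩ := Function.ne_iff.1 hk
    have hne : (Finset.univ.filter fun i => k i ≠ 0).Nonempty := ⟨i, by simpa using hi⟩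
    refine ⟨_, (Finset.mem_filter.1 (Finset.min'_mem _ hne)).2, fun i hi => ?_⟩
    by_contra h
    exact absurd (Finset.min'_le _ i (by simpa using h)) (not_le.2 hi)
  have hpoly : PolySeq (d - j) (k j • (ω : 𝕋))
      (fun n => ∑ i, k i • (skewShift d ω)^[n + 1] x i) := by
    have := PolySeq.sum Finset.univ (m := d - j)
      (β := fun i => if i = j then k j • (ω : 𝕋) else 0)
      (f := fun i n => k i • (skewShift d ω)^[n + 1] x i) fun i _ => by
        have hi := (skewShift_iterate_polySeq d ω x i).shift 1 |>.zsmul (k i)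
        rcases lt_trichotomy i j with h | rfl | h
        · simpa [hjmin i h, h.ne] using PolySeq.zero (d - j)
        · simpa using hi
        · simpa [h.ne'] using hi.mono_of_lt (m' := d - j) (by have := i.2; omega)
    simpa using this
  have hr1 : 1 ≤ d - (j : ℕ) := by have := j.2; omega
  have hd' : (1 : ℝ) ≤ d := by exact_mod_cast hd
  have hp : (4 : ℝ) ≤ 2 ^ (d + 1) := by
    calc (4 : ℝ) = 2 ^ 2 := by norm_num
      _ ≤ _ := pow_le_pow_right₀ (by norm_num) (by omega)
  have hp2 : (2 : ℝ) ^ (d - j + 1) ≤ 2 ^ (d + 1) :=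
    pow_le_pow_right₀ (by norm_num) (by omega)
  have hq : (0 : ℝ) < ((d : ℝ) + 1) * 2 ^ (d + 1) := by positivity
  refine (hC (d - j) hr1 L hL (d / (((d : ℝ) + 1) * 2 ^ (d + 1)))
    (1 / (((d : ℝ) + 1) * 2 ^ (d + 1))) (by positivity) (by positivity) ?_ ?_ ω hω' (k j) hj
    (hkL j) _ hpoly).trans ?_
  · have e : 1 - 1 / ((d : ℝ) + 1) = d * 2 ^ (d + 1) / (((d : ℝ) + 1) * 2 ^ (d + 1)) := by
      field_simp; ring
    rw [e, ← mul_div_assoc, ← mul_div_assoc, ← add_div]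
    refine div_le_div_of_nonneg_right ?_ hq.le
    nlinarith
  · rw [← mul_div_assoc, ← add_div, div_le_one hq]
    nlinarith
  · refine mul_le_mul_of_nonneg_right ?_ (by positivity)
    exact Finset.single_le_sum (f := C) (fun r hr => hC0 r (Finset.mem_Icc.1 hr).1)
      (Finset.mem_Icc.2 ⟨hr1, by omega⟩)

lemma coe_rep (y : 𝕋) : ((rep y : ℝ) : 𝕋) = y := AddCircle.coe_equivIco (p := 1) (a := 0)

lemma rep_mem_Ico (y : 𝕋) : rep y ∈ Set.Ico (0 : ℝ) 1 := by
  simpa [rep] using ((AddCircle.equivIco 1 0) y).2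

/-- Orbit count in a cube of side `1 / m` with `m ≤ ε⁻¹ ≤ 2m`, where `ε = L ^ (-1/((d+1)2^(d+1)))`. -/
lemma exists_card_orbit_cube_le (d : ℕ) (hd : 1 ≤ d) {c : ℝ} (hc : 0 < c) :
    ∃ C : ℝ, 0 ≤ C ∧ ∀ L : ℕ, 1 ≤ L → ∀ ω : ℝ, DiophantineUpTo c L ω → ∀ x : Fin d → 𝕋,
      ∀ m : ℕ, 1 ≤ m → (m : ℝ) ≤ (L : ℝ) ^ (1 / (((d : ℝ) + 1) * 2 ^ (d + 1))) →
      (L : ℝ) ^ (1 / (((d : ℝ) + 1) * 2 ^ (d + 1))) ≤ 2 * m → ∀ v : Fin d → ℕ, ∀ S : Finset ℕ,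
      S ⊆ Finset.range L → (∀ n ∈ S, ∀ i, ⌊m * rep ((skewShift d ω)^[n + 1] x i)⌋₊ = v i) →
      (S.card : ℝ) ≤ C * (L : ℝ) ^ (1 - d / (((d : ℝ) + 1) * 2 ^ (d + 1))) := by
  obtain ⟨C, hC0, hC⟩ := exists_norm_expSum_skewShift_le d hd hc
  refine ⟨4 ^ d * (6 ^ d + C), by positivity, ?_⟩
  intro L hL ω hω x m hm hmL hLm v S hSL hSv
  have hL0 : (0 : ℝ) < L := by exact_mod_cast hL
  have hm0 : (0 : ℝ) < m := by exact_mod_cast hm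
  set K := (m + 2) / 3 with hK
  have hK1 : 1 ≤ K := by omega
  have hKm : K ≤ m := by omega
  have hmK : m ≤ 3 * K := by omega
  have hK0 : (0 : ℝ) < K := by exact_mod_cast hK1
  have h := card_filter_near_le hK1 (fun n => (skewShift d ω)^[n + 1] x)
    (fun i => (((v i + 1 / 2) / m : ℝ) : 𝕋))
    (M := C * (L : ℝ) ^ (1 - d / (((d : ℝ) + 1) * 2 ^ (d + 1)))) (by positivity)
    (fun k hk hkK => hC L hL ω hω x k hk fun i => by
      have h1 : |(k i : ℝ)| ≤ K := by exact_mod_cast (hkK i).le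
      have h2 : (K : ℝ) ≤ m := by exact_mod_cast hKm
      linarith) S hSL (fun n hn i j hj => by
      have h1 := hSv n hn i
      have hr := rep_mem_Ico ((skewShift d ω)^[n + 1] x i)
      rw [Nat.floor_eq_iff (mul_nonneg hm0.le hr.1)] at h1
      have h2 : ‖(skewShift d ω)^[n + 1] x i - (((v i + 1 / 2) / m : ℝ) : 𝕋)‖ ≤ 1 / (2 * m) := by
        rw [← coe_rep ((skewShift d ω)^[n + 1] x i), ← AddCircle.coe_sub]
        refine (norm_coe_le_abs _).trans ?_
        have e : rep ((skewShift d ω)^[n + 1] x i) - (v i + 1 / 2) / m =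
            (m * rep ((skewShift d ω)^[n + 1] x i) - (v i + 1 / 2)) / m := by field_simp
        rw [e, abs_div, abs_of_pos hm0, ← div_div]
        refine div_le_div_of_nonneg_right ?_ hm0.le
        rw [abs_le]
        constructor <;> linarith
      have h3 : (3 * j : ℝ) ≤ m := by
        have : 3 * j ≤ m := by omega
        exact_mod_cast this
      calc _ ≤ 6 * (j : ℝ) * (1 / (2 * m)) := by gcongr
        _ = 3 * j / m := by field_simp; ring
        _ ≤ 1 := (div_le_one hm0).2 h3)
  rw [Fintype.card_fin] at h
  refine h.trans ?_
  rw [mul_assoc]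
  refine mul_le_mul_of_nonneg_left ?_ (by positivity)
  rw [add_mul (6 ^ d)]
  refine add_le_add ?_ le_rfl
  rw [div_le_iff₀ (by positivity), mul_right_comm, ← mul_pow]
  have h6 : (L : ℝ) ^ (1 / (((d : ℝ) + 1) * 2 ^ (d + 1))) ≤ 6 * K := by
    have : (m : ℝ) ≤ 3 * K := by exact_mod_cast hmK
    linarith
  calc (L : ℝ) = ((L : ℝ) ^ (1 / (((d : ℝ) + 1) * 2 ^ (d + 1)))) ^ d *
        (L : ℝ) ^ (1 - d / (((d : ℝ) + 1) * 2 ^ (d + 1))) := by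
        rw [← Real.rpow_natCast, ← Real.rpow_mul hL0.le, ← Real.rpow_add hL0]
        conv_lhs => rw [← Real.rpow_one (L : ℝ)]
        congr 1; ring
    _ ≤ _ := by gcongr

section Bezout

variable {σ : Type*} [Fintype σ] [DecidableEq σ]

/-- Polynomials `F i` in the variables `σ` and a coordinate satisfy an algebraic relation whose degree
in the coordinate is controlled by the degrees of the `F i`. -/
lemma exists_algebraic_relation (F : σ → MvPolynomial σ ℝ) {D : ℕ}
    (hF : ∀ i, (F i).totalDegree ≤ D) (j : σ) :
    ∃ R : Polynomial (MvPolynomial σ ℝ), R ≠ 0 ∧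
      R.natDegree ≤ (Fintype.card σ * D + 1) ^ Fintype.card σ ∧
      ∀ x : σ → ℝ, (R.map (MvPolynomial.eval fun i => MvPolynomial.eval x (F i))).eval (x j) = 0 := by
  set k := Fintype.card σ with hk
  set N := (k * D + 1) ^ k with hN
  let I := (σ → Fin (N + 1)) × Fin (N + 1)
  let Q : (I → ℝ) → MvPolynomial σ ℝ := fun c =>
    ∑ p : I, MvPolynomial.C (c p) * ((∏ i, F i ^ (p.1 i : ℕ)) * MvPolynomial.X j ^ (p.2 : ℕ))
  let T := (N + 1) * (k * D + 1)
  let G : Finset ℝ := (Finset.range T).image (fun n : ℕ => (n : ℝ))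
  have hG : G.card = T := by
    rw [Finset.card_image_of_injective _ Nat.cast_injective, Finset.card_range]
  let Φ : (I → ℝ) →ₗ[ℝ] ((σ → Fin T) → ℝ) :=
    { toFun := fun c y => MvPolynomial.eval (fun i => ((y i : ℕ) : ℝ)) (Q c)
      map_add' := fun c c' => by
        funext y
        simp only [Q, map_sum, map_mul, MvPolynomial.eval_C, Pi.add_apply, add_mul,
          Finset.sum_add_distrib]
      map_smul' := fun a c => by
        funext y
        simp only [Q, map_sum, map_mul, MvPolynomial.eval_C, Pi.smul_apply, smul_eq_mul,
          RingHom.id_apply, mul_assoc, Finset.mul_sum] }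
  have hrank : Module.finrank ℝ ((σ → Fin T) → ℝ) < Module.finrank ℝ (I → ℝ) := by
    rw [Module.finrank_fintype_fun_eq_card, Module.finrank_fintype_fun_eq_card]
    simp only [I, Fintype.card_prod, Fintype.card_fun, Fintype.card_fin, ← hk]
    rw [show T = (N + 1) * (k * D + 1) from rfl, mul_pow, ← hN]
    exact Nat.mul_lt_mul_of_pos_left (Nat.lt_succ_self N) (by positivity)
  obtain ⟨c, hc, hc0⟩ := Submodule.exists_mem_ne_zero_of_ne_bot
    (LinearMap.ker_ne_bot_of_finrank_lt (f := Φ) hrank)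
  have hQdeg : ∀ i, (Q c).degreeOf i < T := fun i => by
    refine ((Q c).degreeOf_le_totalDegree i).trans_lt ?_
    have : (Q c).totalDegree ≤ N * (k * D + 1) := by
      refine MvPolynomial.totalDegree_finsetSum_le fun p _ => ?_
      refine (MvPolynomial.totalDegree_mul _ _).trans ?_
      rw [MvPolynomial.totalDegree_C, zero_add]
      refine (MvPolynomial.totalDegree_mul _ _).trans ?_
      rw [MvPolynomial.totalDegree_X_pow, mul_add, mul_one]
      refine add_le_add ((MvPolynomial.totalDegree_finsetProd _ _).trans ?_) (by omega)
      calc ∑ i, (F i ^ (p.1 i : ℕ)).totalDegree ≤ ∑ i : σ, N * D := by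
            refine Finset.sum_le_sum fun i _ => (MvPolynomial.totalDegree_pow _ _).trans ?_
            exact Nat.mul_le_mul (by omega) (hF i)
        _ = N * (k * D) := by simp [← hk]; ring
    refine this.trans_lt ?_
    exact Nat.mul_lt_mul_of_pos_right (Nat.lt_succ_self N) (by positivity)
  have hQ0 : Q c = 0 := by
    refine MvPolynomial.eq_zero_of_eval_zero_at_prod_finset (Q c) (fun _ => G)
      (fun i => by rw [hG]; exact hQdeg i) fun x hx => ?_
    have hx' : ∀ i, ∃ n : ℕ, n < T ∧ (n : ℝ) = x i := fun i => by
      simpa [G] using hx i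
    choose y hy hyx using hx'
    have := congrFun (LinearMap.mem_ker.1 hc) fun i => ⟨y i, hy i⟩
    simpa [Φ, hyx] using this
  let α : (σ → Fin (N + 1)) → (σ →₀ ℕ) := fun a => Finsupp.equivFunOnFinite.symm fun i => (a i : ℕ)
  have hα : Function.Injective α := fun a b h => by
    funext i
    have := DFunLike.congr_fun h i
    exact Fin.ext (by simpa [α] using this)
  refine ⟨∑ p : I, Polynomial.monomial (p.2 : ℕ) (MvPolynomial.monomial (α p.1) (c p)), ?_, ?_, ?_⟩
  · intro h
    apply hc0
    funext p
    have h1 := congrArg (fun R => MvPolynomial.coeff (α p.1) (Polynomial.coeff R (p.2 : ℕ))) h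
    simp only [Polynomial.finsetSum_coeff, Polynomial.coeff_monomial, MvPolynomial.coeff_sum,
      Polynomial.coeff_zero, MvPolynomial.coeff_zero] at h1
    rw [Finset.sum_eq_single p] at h1
    · simpa using h1
    · intro b _ hb
      split_ifs with h2
      · rw [MvPolynomial.coeff_monomial, if_neg]
        intro h3
        exact hb (Prod.ext (hα h3) (Fin.ext h2))
      · simp
    · simp
  · refine Polynomial.natDegree_sum_le_of_forall_le _ _ fun p _ => ?_
    exact (Polynomial.natDegree_monomial_le _).trans (by omega)
  · intro x
    have := congrArg (MvPolynomial.eval x) hQ0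
    simp only [Q, map_sum, map_mul, MvPolynomial.eval_C, map_prod, map_pow, MvPolynomial.eval_X,
      map_zero] at this
    rw [Polynomial.map_sum, Polynomial.eval_finsetSum, ← this]
    refine Finset.sum_congr rfl fun p _ => ?_
    rw [Polynomial.map_monomial, Polynomial.eval_monomial, MvPolynomial.eval_monomial,
      Finsupp.prod_fintype _ _ (by simp)]
    simp [α, mul_assoc]

/-- A weak form of Bézout's theorem: if for every `u` in a nonempty open set the system `F x = u` has
at least `#V` distinct solutions, then `#V` is bounded in terms of the degree of `F`. -/
lemma card_le_of_forall_mem_open_exists_solution (F : σ → MvPolynomial σ ℝ) {D : ℕ}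
    (hF : ∀ i, (F i).totalDegree ≤ D) {U : Set (σ → ℝ)} (hU : IsOpen U) (hUne : U.Nonempty)
    {κ : Type*} (V : Finset κ)
    (h : ∀ u ∈ U, ∃ x : κ → σ → ℝ, Set.InjOn x V ∧
      ∀ v ∈ V, ∀ i, MvPolynomial.eval (x v) (F i) = u i) :
    V.card ≤ ((Fintype.card σ * D + 1) ^ Fintype.card σ) ^ Fintype.card σ := by
  choose R hR0 hRdeg hR using exists_algebraic_relation F hF
  have hlead : ∏ j, (R j).leadingCoeff ≠ 0 :=
    Finset.prod_ne_zero_iff.2 fun j _ => Polynomial.leadingCoeff_ne_zero.2 (hR0 j)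
  obtain ⟨u, huU, hu⟩ : ∃ u ∈ U, MvPolynomial.eval u (∏ j, (R j).leadingCoeff) ≠ 0 := by
    by_contra! hcon
    obtain ⟨u₀, hu₀⟩ := hUne
    obtain ⟨r, hr, hball⟩ := Metric.isOpen_iff.1 hU u₀ hu₀
    refine hlead (MvPolynomial.funext_set (fun i => Metric.ball (u₀ i) r) (fun i => ?_)
      fun x hx => ?_)
    · rw [Real.ball_eq_Ioo]
      exact Set.Ioo_infinite (by linarith)
    · rw [map_zero]
      refine hcon x (hball ?_)
      rw [Metric.mem_ball, dist_pi_lt_iff hr]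
      exact fun i => hx i trivial
  rw [map_prod, Finset.prod_ne_zero_iff] at hu
  obtain ⟨x, hxinj, hx⟩ := h u huU
  have hmap0 : ∀ j, (R j).map (MvPolynomial.eval u) ≠ 0 := fun j h0 => by
    have := congrArg (fun p => Polynomial.coeff p (R j).natDegree) h0
    simp only [Polynomial.coeff_map, Polynomial.coeff_zero] at this
    exact hu j (Finset.mem_univ j) this
  calc V.card ≤ (Fintype.piFinset fun j => ((R j).map (MvPolynomial.eval u)).roots.toFinset).card := by
        refine Finset.card_le_card_of_injOn x (fun v hv => ?_) hxinj
        rw [Finset.mem_coe, Fintype.mem_piFinset]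
        intro j
        rw [Multiset.mem_toFinset, Polynomial.mem_roots (hmap0 j), Polynomial.IsRoot.def]
        have := hR j (x v)
        rwa [show (fun i => MvPolynomial.eval (x v) (F i)) = u from funext (hx v hv)] at this
    _ ≤ ∏ _j : σ, (Fintype.card σ * D + 1) ^ Fintype.card σ := by
        rw [Fintype.card_piFinset]
        refine Finset.prod_le_prod' fun j _ => ?_
        refine (Multiset.toFinset_card_le _).trans ((Polynomial.card_roots' _).trans ?_)
        exact Polynomial.natDegree_map_le.trans (hRdeg j)
    _ = _ := by simp

end Bezout

lemma MvPolynomial.totalDegree_pderiv_le_totalDegree {σ : Type*} [Fintype σ]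
    (p : MvPolynomial σ ℝ) (i : σ) :
    (MvPolynomial.pderiv i p).totalDegree ≤ p.totalDegree := by
  conv_lhs => rw [p.as_sum, map_sum]
  refine MvPolynomial.totalDegree_finsetSum_le fun s hs => ?_
  rw [MvPolynomial.pderiv_monomial]
  refine (MvPolynomial.totalDegree_monomial_le _ _).trans ?_
  refine le_trans ?_ (MvPolynomial.le_totalDegree hs)
  rw [Finsupp.sum_fintype _ _ (by simp), Finsupp.sum_fintype _ _ (by simp)]
  exact Finset.sum_le_sum fun a _ => by simp

lemma MvPolynomial.hasDerivAt_eval_update {σ : Type*} [DecidableEq σ]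
    (p : MvPolynomial σ ℝ) (i : σ) (x : σ → ℝ) :
    HasDerivAt (fun t => MvPolynomial.eval (Function.update x i t) p)
      (MvPolynomial.eval x (MvPolynomial.pderiv i p)) (x i) := by
  induction p using MvPolynomial.induction_on with
  | C a => simpa using hasDerivAt_const (x i) a
  | add p q hp hq =>
    simp only [map_add]
    exact hp.add hq
  | mul_X p j hp =>
    have hX : HasDerivAt (fun t => Function.update x i t j)
        (MvPolynomial.eval x (MvPolynomial.pderiv i (MvPolynomial.X j))) (x i) := by
      rcases eq_or_ne j i with rfl | hj
      · simp only [Function.update_self, MvPolynomial.pderiv_X_self, map_one]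
        exact hasDerivAt_id' (x j)
      · simpa [hj, MvPolynomial.pderiv_X_of_ne hj] using hasDerivAt_const (x i) (x j)
    have h := hp.mul hX
    simp only [Function.update_eq_self] at h
    simp only [map_mul, MvPolynomial.eval_X, Derivation.leibniz, smul_eq_mul, map_add]
    refine HasDerivAt.congr_deriv h ?_
    ring

/-- If a polynomial has a zero in each of the cubes of side `1 / m` with corners `w / m`, `w ∈ V`,
and no zero on the boundaries of these cubes, then the number of cubes is bounded in terms of the
degree. -/
lemma card_le_of_zeros_interior {σ : Type*} [Fintype σ] (Q : MvPolynomial σ ℝ) {D : ℕ}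
    (hQ : Q.totalDegree ≤ D) {m : ℕ} (hm : 1 ≤ m) (V : Finset (σ → ℕ))
    (hex : ∀ w ∈ V, ∃ x : σ → ℝ, (∀ i, (w i : ℝ) ≤ m * x i ∧ m * x i ≤ w i + 1) ∧
      MvPolynomial.eval x Q = 0)
    (hint : ∀ w ∈ V, ∀ x : σ → ℝ, (∀ i, (w i : ℝ) ≤ m * x i ∧ m * x i ≤ w i + 1) →
      MvPolynomial.eval x Q = 0 → ∀ i, (w i : ℝ) < m * x i ∧ m * x i < w i + 1) :
    V.card ≤ ((Fintype.card σ * (2 * D) + 1) ^ Fintype.card σ) ^ Fintype.card σ := by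
  classical
  have hm0 : (0 : ℝ) < m := by exact_mod_cast hm
  let K : (σ → ℕ) → Set (σ → ℝ) := fun w => {x | ∀ i, (w i : ℝ) ≤ m * x i ∧ m * x i ≤ w i + 1}
  have hKcomp : ∀ w, IsCompact (K w) := fun w => by
    have : K w = Set.univ.pi fun i => Set.Icc ((w i : ℝ) / m) ((w i + 1) / m) := by
      ext x
      simp only [K, Set.mem_ofPred_eq, Set.mem_univ_pi, Set.mem_Icc, div_le_iff₀ hm0,
        le_div_iff₀ hm0, mul_comm]
    rw [this]
    exact isCompact_univ_pi fun i => isCompact_Icc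
  let A : (σ → ℕ) → Set (σ → ℝ) := fun w =>
    K w ∩ {x | ∃ i, m * x i = w i ∨ m * x i = w i + 1}
  have hAcomp : ∀ w, IsCompact (A w) := fun w => by
    refine (hKcomp w).inter_right ?_
    simp only [Set.ofPred_exists, Set.ofPred_or]
    exact isClosed_iUnion_of_finite fun i =>
      (isClosed_eq (by fun_prop) (by fun_prop)).union (isClosed_eq (by fun_prop) (by fun_prop))
  obtain ⟨μ, hμ, hμA⟩ : ∃ μ : ℝ, 0 < μ ∧ ∀ w ∈ V, ∀ x ∈ A w, μ ≤ MvPolynomial.eval x (Q ^ 2) := by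
    rcases (⋃ w ∈ V, A w).eq_empty_or_nonempty with h | h
    · refine ⟨1, one_pos, fun w hw x hx => ?_⟩
      have : x ∈ ⋃ w ∈ V, A w := Set.mem_biUnion (s := {w | w ∈ V}) hw hx
      simp [h] at this
    · obtain ⟨y, hy, hmin⟩ := (V.isCompact_biUnion fun w _ => hAcomp w).exists_isMinOn h
        (MvPolynomial.continuous_eval (Q ^ 2)).continuousOn
      refine ⟨MvPolynomial.eval y (Q ^ 2), ?_, fun w hw x hx =>
        hmin (Set.mem_biUnion (s := {w | w ∈ V}) hw hx)⟩
      rw [map_pow]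
      refine sq_pos_of_ne_zero fun h0 => ?_
      obtain ⟨w, hw, hyK, i, hi⟩ := Set.mem_iUnion₂.1 hy
      have := hint w hw y hyK h0 i
      rcases hi with hi | hi <;> linarith
  set k := Fintype.card σ with hk
  have hr : 0 < μ / (k + 1) := by positivity
  refine card_le_of_forall_mem_open_exists_solution (fun i => MvPolynomial.pderiv i (Q ^ 2))
    (fun i => (MvPolynomial.totalDegree_pderiv_le_totalDegree _ _).trans
      ((MvPolynomial.totalDegree_pow _ _).trans (Nat.mul_le_mul_left 2 hQ)))
    (Metric.isOpen_ball (x := (0 : σ → ℝ)) (ε := μ / (k + 1))) ⟨0, Metric.mem_ball_self hr⟩ V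
    fun u hu => ?_
  have hu' : ∀ i, |u i| ≤ μ / (k + 1) := fun i => by
    have := (norm_le_pi_norm u i).trans (mem_ball_zero_iff.1 hu).le
    simpa using this
  have key : ∀ w ∈ V, ∃ y : σ → ℝ, (∀ i, (w i : ℝ) < m * y i ∧ m * y i < w i + 1) ∧
      ∀ i, MvPolynomial.eval y (MvPolynomial.pderiv i (Q ^ 2)) = u i := by
    intro w hw
    obtain ⟨x₀, hx₀K, hx₀⟩ := hex w hw
    set G : MvPolynomial σ ℝ := Q ^ 2 - ∑ i, MvPolynomial.C (u i) * MvPolynomial.X i with hG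
    obtain ⟨y, hyK, hmin⟩ := (hKcomp w).exists_isMinOn ⟨x₀, hx₀K⟩
      (MvPolynomial.continuous_eval G).continuousOn
    have hyA : y ∉ A w := by
      intro hyA
      have h1 := hμA w hw y hyA
      have h2 : MvPolynomial.eval y G ≤ MvPolynomial.eval x₀ G := hmin hx₀K
      simp only [hG, map_sub, map_pow, hx₀, map_sum, map_mul, MvPolynomial.eval_C,
        MvPolynomial.eval_X] at h1 h2
      have h3 : ∑ i, u i * y i - ∑ i, u i * x₀ i ≤ ∑ _i : σ, μ / (k + 1) := by
        rw [← Finset.sum_sub_distrib]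
        refine Finset.sum_le_sum fun i _ => ?_
        have h4 : |y i - x₀ i| ≤ 1 := by
          have h5 := hyK i
          have h6 := hx₀K i
          have hm1 : (1 : ℝ) ≤ m := by exact_mod_cast hm
          have h7 : |m * (y i - x₀ i)| ≤ 1 := abs_le.2 ⟨by linarith, by linarith⟩
          rw [abs_mul, abs_of_pos hm0] at h7
          nlinarith [abs_nonneg (y i - x₀ i)]
        calc u i * y i - u i * x₀ i = u i * (y i - x₀ i) := by ring
          _ ≤ |u i| * |y i - x₀ i| := by rw [← abs_mul]; exact le_abs_self _
          _ ≤ μ / (k + 1) * 1 := mul_le_mul (hu' i) h4 (abs_nonneg _) hr.le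
          _ = _ := mul_one _
      rw [Finset.sum_const, Finset.card_univ, ← hk, nsmul_eq_mul] at h3
      have h8 : (k : ℝ) * (μ / (k + 1)) < μ := by
        rw [mul_div_assoc', div_lt_iff₀ (by positivity)]
        linarith
      linarith
    have hyint : ∀ i, (w i : ℝ) < m * y i ∧ m * y i < w i + 1 := by
      intro i
      by_contra hcon
      refine hyA ⟨hyK, i, ?_⟩
      rw [not_and_or, not_lt, not_lt] at hcon
      exact hcon.imp (fun h => le_antisymm h (hyK i).1) fun h => le_antisymm (hyK i).2 h
    refine ⟨y, hyint, fun i => ?_⟩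
    have hloc : IsLocalMin (fun t => MvPolynomial.eval (Function.update y i t) G) (y i) := by
      have hev : ∀ᶠ t in nhds (y i), (w i : ℝ) < m * t ∧ m * t < w i + 1 := by
        have hc : Continuous fun t : ℝ => m * t := by fun_prop
        exact ((isOpen_lt continuous_const hc).inter (isOpen_lt hc continuous_const)).mem_nhds
          (hyint i)
      filter_upwards [hev] with t ht
      rw [Function.update_eq_self]
      refine hmin fun j => ?_
      rcases eq_or_ne j i with rfl | hj
      · rw [Function.update_self]
        exact ⟨ht.1.le, ht.2.le⟩
      · rw [Function.update_of_ne hj]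
        exact hyK j
    have h0 := hloc.hasDerivAt_eq_zero (MvPolynomial.hasDerivAt_eval_update G i y)
    have h1 : MvPolynomial.pderiv i G = MvPolynomial.pderiv i (Q ^ 2) - MvPolynomial.C (u i) := by
      rw [hG, map_sub, map_sum]
      congr 1
      rw [Finset.sum_eq_single i]
      · simp
      · intro j _ hj
        simp [MvPolynomial.pderiv_X_of_ne hj]
      · simp
    rw [h1, map_sub, MvPolynomial.eval_C, sub_eq_zero] at h0
    exact h0
  choose! x hxint hx using key
  refine ⟨x, fun w hw w' hw' hww => funext fun i => ?_, hx⟩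
  have h1 := hxint w hw i
  have h2 := hxint w' hw' i
  rw [← hww] at h2
  have h3 : (w i : ℝ) < w' i + 1 := h1.1.trans h2.2
  have h4 : (w' i : ℝ) < w i + 1 := h2.1.trans h1.2
  norm_cast at h3 h4
  omega

/-- Substituting polynomials of degree at most one does not increase the total degree. -/
lemma MvPolynomial.totalDegree_aeval_le {σ τ : Type*} [Fintype σ] (p : MvPolynomial σ ℝ)
    (f : σ → MvPolynomial τ ℝ) (hf : ∀ i, (f i).totalDegree ≤ 1) :
    (MvPolynomial.aeval f p).totalDegree ≤ p.totalDegree := by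
  rw [MvPolynomial.aeval_def, MvPolynomial.eval₂_eq']
  refine MvPolynomial.totalDegree_finsetSum_le fun s hs => ?_
  refine (MvPolynomial.totalDegree_mul _ _).trans ?_
  rw [MvPolynomial.algebraMap_eq, MvPolynomial.totalDegree_C, zero_add]
  refine (MvPolynomial.totalDegree_finsetProd _ _).trans ?_
  refine le_trans ?_ (MvPolynomial.le_totalDegree hs)
  rw [Finsupp.sum_fintype _ _ (by simp)]
  refine Finset.sum_le_sum fun i _ => (MvPolynomial.totalDegree_pow _ _).trans ?_
  simpa using Nat.mul_le_mul_left (s i) (hf i)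

/-- The number of points of the grid `{0, 1/m, …, 1}^d` at which a nonzero polynomial vanishes. -/
lemma card_grid_zeros_le {d : ℕ} (hd : 1 ≤ d) {P : MvPolynomial (Fin d) ℝ} (hP : P ≠ 0) {D : ℕ}
    (hD : P.totalDegree ≤ D) {m : ℕ} (hm : 1 ≤ m) (W : Finset (Fin d → ℕ))
    (hWm : ∀ w ∈ W, ∀ i, w i ≤ m)
    (hW : ∀ w ∈ W, MvPolynomial.eval (fun i => (w i : ℝ) / m) P = 0) :
    W.card ≤ D * (m + 1) ^ (d - 1) := by
  classical
  have hm0 : (m : ℝ) ≠ 0 := by positivity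
  let G : Finset ℝ := (Finset.range (m + 1)).image fun n : ℕ => (n : ℝ) / m
  have hinj : Function.Injective fun n : ℕ => (n : ℝ) / m := fun a b h => by
    simpa [div_left_inj' hm0] using h
  have hG : G.card = m + 1 := by rw [Finset.card_image_of_injective _ hinj, Finset.card_range]
  have hsz := MvPolynomial.schwartz_zippel_totalDegree hP G
  rw [hG, div_le_div_iff₀ (by positivity) (by positivity)] at hsz
  norm_cast at hsz
  have hcard : W.card ≤ (Finset.filter (fun f => MvPolynomial.eval f P = 0)
      (Fintype.piFinset fun _ : Fin d => G)).card := by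
    refine Finset.card_le_card_of_injOn (fun w i => (w i : ℝ) / m) (fun w hw => ?_)
      fun w _ w' _ h => funext fun i => hinj (congrFun h i)
    rw [Finset.mem_coe, Finset.mem_filter, Fintype.mem_piFinset]
    exact ⟨fun i => Finset.mem_image_of_mem _
      (Finset.mem_range.2 (Nat.lt_succ_of_le (hWm w hw i))), hW w hw⟩
  obtain ⟨e, rfl⟩ : ∃ e, d = e + 1 := ⟨d - 1, by omega⟩
  refine Nat.le_of_mul_le_mul_right (c := m + 1) ?_ (by omega)
  calc W.card * (m + 1) ≤ P.totalDegree * (m + 1) ^ (e + 1) :=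
        (Nat.mul_le_mul_right _ hcard).trans hsz
    _ ≤ D * (m + 1) ^ (e + 1) := Nat.mul_le_mul_right _ hD
    _ = D * (m + 1) ^ (e + 1 - 1) * (m + 1) := by simp [pow_succ, mul_assoc]

/-- The number of faces of grid cubes, parallel to the coordinates in `S`, which contain a zero of a
nonzero polynomial but no zero on their relative boundary. -/
lemma card_faces_le {d : ℕ} (hd : 1 ≤ d) {P : MvPolynomial (Fin d) ℝ} (hP : P ≠ 0) {D : ℕ}
    (hD1 : 1 ≤ D) (hD : P.totalDegree ≤ D) {m : ℕ} (hm : 1 ≤ m) (S : Finset (Fin d))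
    (W : Finset (Fin d → ℕ)) (hWm : ∀ w ∈ W, ∀ i, w i ≤ m)
    (hex : ∀ w ∈ W, ∃ x : Fin d → ℝ, (∀ i ∈ S, (w i : ℝ) ≤ m * x i ∧ m * x i ≤ w i + 1) ∧
      (∀ i ∉ S, m * x i = w i) ∧ MvPolynomial.eval x P = 0)
    (hint : ∀ w ∈ W, ∀ x : Fin d → ℝ, (∀ i ∈ S, (w i : ℝ) ≤ m * x i ∧ m * x i ≤ w i + 1) →
      (∀ i ∉ S, m * x i = w i) → MvPolynomial.eval x P = 0 →
      ∀ i ∈ S, (w i : ℝ) < m * x i ∧ m * x i < w i + 1) :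
    W.card ≤ ((d * (2 * D) + 1) ^ d) ^ d * (m + 1) ^ (d - 1) := by
  classical
  have hm0 : (m : ℝ) ≠ 0 := by positivity
  rcases S.eq_empty_or_nonempty with rfl | hS
  · refine (card_grid_zeros_le hd hP hD hm W hWm fun w hw => ?_).trans
      (Nat.mul_le_mul_right _ ?_)
    · obtain ⟨x, -, hx, hx0⟩ := hex w hw
      rwa [show (fun i => (w i : ℝ) / m) = x from funext fun i => by
        rw [← hx i (by simp), mul_div_cancel_left₀ _ hm0]]
    · have h1 : d * (2 * D) + 1 ≤ ((d * (2 * D) + 1) ^ d) ^ d := by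
        rw [← pow_mul]
        exact Nat.le_self_pow (by positivity) _
      nlinarith
  · let r : (Fin d → ℕ) → ({i // i ∉ S} → ℕ) := fun w i => w i
    have hmaps : ∀ w ∈ W, r w ∈ Fintype.piFinset fun _ : {i // i ∉ S} => Finset.range (m + 1) :=
      fun w hw => Fintype.mem_piFinset.2 fun i => Finset.mem_range.2 (Nat.lt_succ_of_le (hWm w hw i))
    have hScard : S.card ≤ d := by simpa using Finset.card_le_univ S
    refine (Finset.card_le_mul_card_image_of_maps_to hmaps (((d * (2 * D) + 1) ^ d) ^ d)
      fun a _ => ?_).trans (Nat.mul_le_mul_left _ ?_)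
    · let f : Fin d → MvPolynomial S ℝ := fun i =>
        if h : i ∈ S then MvPolynomial.X ⟨i, h⟩ else MvPolynomial.C ((a ⟨i, h⟩ : ℝ) / m)
      have hf : ∀ i, (f i).totalDegree ≤ 1 := fun i => by
        by_cases h : i ∈ S <;> simp [f, h]
      let extend : (S → ℝ) → Fin d → ℝ := fun y i =>
        if h : i ∈ S then y ⟨i, h⟩ else (a ⟨i, h⟩ : ℝ) / m
      have heval : ∀ y : S → ℝ, MvPolynomial.eval y (MvPolynomial.aeval f P) =
          MvPolynomial.eval (extend y) P := fun y => by
        rw [← MvPolynomial.bind₁, MvPolynomial.eval, MvPolynomial.eval₂Hom_bind₁]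
        congr 2
        funext i
        by_cases h : i ∈ S <;> simp [f, extend, h]
      set Wa := W.filter fun w => r w = a with hWa
      have hmem : ∀ w ∈ Wa, w ∈ W ∧ ∀ i (h : i ∉ S), w i = a ⟨i, h⟩ := fun w hw => by
        rw [hWa, Finset.mem_filter] at hw
        exact ⟨hw.1, fun i h => congrFun hw.2 ⟨i, h⟩⟩
      have hinj : Set.InjOn (fun (w : Fin d → ℕ) (i : S) => w i) Wa := by
        intro w hw w' hw' h
        funext i
        by_cases hi : i ∈ S
        · exact congrFun h ⟨i, hi⟩
        · rw [(hmem w hw).2 i hi, (hmem w' hw').2 i hi]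
      rw [← Finset.card_image_of_injOn hinj]
      refine (card_le_of_zeros_interior (MvPolynomial.aeval f P)
        ((MvPolynomial.totalDegree_aeval_le P f hf).trans hD) hm _ ?_ ?_).trans ?_
      · intro z hz
        obtain ⟨w, hw, rfl⟩ := Finset.mem_image.1 hz
        obtain ⟨hwW, hwa⟩ := hmem w hw
        obtain ⟨x, hxS, hx, hx0⟩ := hex w hwW
        refine ⟨fun i => x i, fun i => hxS i i.2, ?_⟩
        rw [heval, ← hx0]
        congr 2
        funext i
        by_cases h : i ∈ S
        · simp [extend, h]
        · simp only [extend, h, dite_false]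
          rw [← hwa i h, ← hx i h, mul_div_cancel_left₀ _ hm0]
      · intro z hz
        obtain ⟨w, hw, rfl⟩ := Finset.mem_image.1 hz
        obtain ⟨hwW, hwa⟩ := hmem w hw
        intro x hx hx0 i
        rw [heval] at hx0
        have h1 := hint w hwW (extend x) (fun j hj => by simpa [extend, hj] using hx ⟨j, hj⟩)
          (fun j hj => by
            simp only [extend, hj, dite_false]
            rw [mul_div_cancel₀ _ hm0, hwa j hj]) hx0 i i.2
        simpa [extend] using h1
      · rw [Fintype.card_coe, ← pow_mul, ← pow_mul]
        calc (S.card * (2 * D) + 1) ^ (S.card * S.card) ≤ (d * (2 * D) + 1) ^ (S.card * S.card) := by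
              gcongr
          _ ≤ _ := Nat.pow_le_pow_right (by omega) (Nat.mul_le_mul hScard hScard)
    · rw [Fintype.card_piFinset]
      simp only [Finset.card_range, Finset.prod_const, Finset.card_univ]
      refine Nat.pow_le_pow_right (by omega) ?_
      rw [Fintype.card_subtype_compl, Fintype.card_fin, Fintype.card_coe]
      have := hS.card_pos
      omega

/-- The zero set of a nonzero polynomial meets few cubes of a regular grid. -/
lemma card_cubes_with_zero_le {d : ℕ} (hd : 1 ≤ d) {P : MvPolynomial (Fin d) ℝ} (hP : P ≠ 0)
    {D : ℕ} (hD1 : 1 ≤ D) (hD : P.totalDegree ≤ D) {m : ℕ} (hm : 1 ≤ m) (V : Finset (Fin d → ℕ))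
    (hVm : ∀ v ∈ V, ∀ i, v i < m)
    (hV : ∀ v ∈ V, ∃ x : Fin d → ℝ, (∀ i, (v i : ℝ) ≤ m * x i ∧ m * x i ≤ v i + 1) ∧
      MvPolynomial.eval x P = 0) :
    V.card ≤ 4 ^ d * ((d * (2 * D) + 1) ^ d) ^ d * (m + 1) ^ (d - 1) := by
  classical
  let face : (Fin d → ℕ) → Finset (Fin d) → (Fin d → ℕ) → Prop := fun v S w =>
    (∀ i, w i = v i ∨ w i = v i + 1) ∧ (∀ i ∈ S, w i = v i) ∧
    ∃ x : Fin d → ℝ, (∀ i ∈ S, (w i : ℝ) ≤ m * x i ∧ m * x i ≤ w i + 1) ∧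
      (∀ i ∉ S, m * x i = w i) ∧ MvPolynomial.eval x P = 0
  have hmin : ∀ v ∈ V, ∃ S w, face v S w ∧ ∀ x : Fin d → ℝ,
      (∀ i ∈ S, (w i : ℝ) ≤ m * x i ∧ m * x i ≤ w i + 1) →
      (∀ i ∉ S, m * x i = w i) → MvPolynomial.eval x P = 0 →
      ∀ i ∈ S, (w i : ℝ) < m * x i ∧ m * x i < w i + 1 := by
    intro v hv
    have hne : ∃ n S w, Finset.card S = n ∧ face v S w := by
      obtain ⟨x, hx, hx0⟩ := hV v hv
      exact ⟨_, Finset.univ, v, rfl, fun i => Or.inl rfl, fun i _ => rfl, x, fun i _ => hx i,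
        fun i hi => absurd (Finset.mem_univ i) hi, hx0⟩
    obtain ⟨S, w, hS, hface⟩ := Nat.find_spec hne
    refine ⟨S, w, hface, fun x hxS hx hx0 i hi => ?_⟩
    have hupd : ∀ b : ℕ, (b = v i ∨ b = v i + 1) → m * x i ≠ b := by
      intro b hb hxb
      refine Nat.find_min hne (m := (S.erase i).card)
        (by rw [← hS]; exact Finset.card_erase_lt_of_mem hi)
        ⟨S.erase i, Function.update w i b, rfl, fun j => ?_, fun j hj => ?_, x, fun j hj => ?_,
          fun j hj => ?_, hx0⟩
      · rcases eq_or_ne j i with rfl | hj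
        · simpa using hb
        · simpa [hj] using hface.1 j
      · rw [Finset.mem_erase] at hj
        simpa [hj.1] using hface.2.1 j hj.2
      · rw [Finset.mem_erase] at hj
        simpa [hj.1] using hxS j hj.2
      · rcases eq_or_ne j i with rfl | hji
        · simpa using hxb
        · simpa [hji] using hx j fun h => hj (Finset.mem_erase.2 ⟨hji, h⟩)
    have h1 := hupd (v i) (Or.inl rfl)
    have h2 := hupd (v i + 1) (Or.inr rfl)
    rw [← hface.2.1 i hi] at h1 h2
    push_cast at h2
    exact ⟨lt_of_le_of_ne (hxS i hi).1 h1.symm, lt_of_le_of_ne (hxS i hi).2 h2⟩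
  choose! S w hface hint using hmin
  let T : (Fin d → ℕ) → Finset (Fin d) := fun v => Finset.univ.filter fun i => w v i = v i + 1
  have hcount := Finset.card_le_mul_card_image_of_maps_to (s := V) (t := Finset.univ)
    (f := fun v => (S v, T v)) (fun _ _ => Finset.mem_univ _)
    (((d * (2 * D) + 1) ^ d) ^ d * (m + 1) ^ (d - 1)) fun p _ => by
      set Vp := V.filter fun v => (S v, T v) = p with hVp
      have hmem : ∀ v ∈ Vp, v ∈ V ∧ S v = p.1 ∧ T v = p.2 := fun v hv => by
        rw [hVp, Finset.mem_filter] at hv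
        exact ⟨hv.1, congrArg Prod.fst hv.2, congrArg Prod.snd hv.2⟩
      have hT : ∀ v ∈ Vp, ∀ i, w v i = v i + if i ∈ p.2 then 1 else 0 := fun v hv i => by
        obtain ⟨hvV, -, hvT⟩ := hmem v hv
        rw [← hvT]
        rcases (hface v hvV).1 i with h | h <;> simp [T, h]
      have hinj : Set.InjOn w Vp := fun v hv v' hv' h => funext fun i => by
        have h1 := hT v hv i
        rw [h, hT v' hv' i] at h1
        omega
      rw [← Finset.card_image_of_injOn hinj]
      refine card_faces_le hd hP hD1 hD hm p.1 _ ?_ ?_ ?_ <;> intro z hz <;>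
        obtain ⟨v, hv, rfl⟩ := Finset.mem_image.1 hz <;> obtain ⟨hvV, hvS, -⟩ := hmem v hv
      · intro i
        have := hVm v hvV i
        rcases (hface v hvV).1 i with h | h <;> omega
      · rw [← hvS]
        exact (hface v hvV).2.2
      · rw [← hvS]
        exact hint v hvV
  refine hcount.trans (le_of_eq ?_)
  rw [Finset.card_univ, Fintype.card_prod, Fintype.card_finset, Fintype.card_fin, ← mul_pow]
  ring

/-- Over a connected set which a semi-algebraic set neither contains nor misses, one of the defining
polynomials is nonzero and has a zero. -/
lemma exists_zero_of_mem_of_notMem {n s : ℕ} (P : Fin s → MvPolynomial (Fin n) ℝ)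
    (𝒞 : Finset (Finset (Fin s) × (Fin s → Fin 3))) {K : Set (Fin n → ℝ)} (hK : IsPreconnected K)
    {y y' : Fin n → ℝ} (hyK : y ∈ K) (hyK' : y' ∈ K) (hy : y ∈ ⋃ cc ∈ 𝒞, SAcell P cc)
    (hy' : y' ∉ ⋃ cc ∈ 𝒞, SAcell P cc) :
    ∃ l, P l ≠ 0 ∧ ∃ x ∈ K, MvPolynomial.eval x (P l) = 0 := by
  by_contra! hcon
  have hle : ∀ l, ∀ a ∈ K, ∀ b ∈ K, MvPolynomial.eval a (P l) ≤ 0 → MvPolynomial.eval b (P l) ≤ 0 := by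
    intro l a ha b hb hab
    rcases eq_or_ne (P l) 0 with h0 | h0
    · simp [h0]
    · by_contra! hlt
      obtain ⟨x, hx, hx0⟩ := hK.intermediate_value ha hb
        (MvPolynomial.continuous_eval (P l)).continuousOn ⟨hab, hlt.le⟩
      exact hcon l h0 x hx hx0
  have hge : ∀ l, ∀ a ∈ K, ∀ b ∈ K, 0 ≤ MvPolynomial.eval a (P l) → 0 ≤ MvPolynomial.eval b (P l) := by
    intro l a ha b hb hab
    rcases eq_or_ne (P l) 0 with h0 | h0
    · simp [h0]
    · by_contra! hlt
      obtain ⟨x, hx, hx0⟩ := hK.intermediate_value hb ha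
        (MvPolynomial.continuous_eval (P l)).continuousOn ⟨hlt.le, hab⟩
      exact hcon l h0 x hx hx0
  obtain ⟨cc, hcc, hycc⟩ := Set.mem_iUnion₂.1 hy
  refine hy' (Set.mem_iUnion₂.2 ⟨cc, hcc, fun l hl => ?_⟩)
  obtain ⟨h0, h1, h2⟩ := hycc l hl
  exact ⟨fun h => hle l y hyK y' hyK' (h0 h),
    fun h => le_antisymm (hle l y hyK y' hyK' (h1 h).le) (hge l y hyK y' hyK' (h1 h).ge),
    fun h => hge l y hyK y' hyK' (h2 h)⟩

/-- The number of grid cubes that a semi-algebraic set meets without containing them. -/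
lemma card_boundary_cubes_le {d : ℕ} (hd : 1 ≤ d) {B : ℝ} {Ω : Set (Fin d → ℝ)}
    (hΩ : IsSemialgebraic d B Ω) {m : ℕ} (hm : 1 ≤ m) (hB : 0 ≤ B) (V : Finset (Fin d → ℕ))
    (hVm : ∀ v ∈ V, ∀ i, v i < m)
    (hV : ∀ v ∈ V, ∃ y y' : Fin d → ℝ, (∀ i, (v i : ℝ) ≤ m * y i ∧ m * y i ≤ v i + 1) ∧
      (∀ i, (v i : ℝ) ≤ m * y' i ∧ m * y' i ≤ v i + 1) ∧ y ∈ Ω ∧ y' ∉ Ω) :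
    (V.card : ℝ) ≤ 4 ^ d * (2 * d + 1) ^ (d * d) * B ^ (1 + d * d) * (m + 1) ^ (d - 1) := by
  classical
  obtain ⟨s, d₀, P, 𝒞, hdeg, hsB, rfl⟩ := hΩ
  have hm0 : (0 : ℝ) < m := by exact_mod_cast hm
  have hzero : ∀ v ∈ V, ∃ l, P l ≠ 0 ∧ ∃ x : Fin d → ℝ,
      (∀ i, (v i : ℝ) ≤ m * x i ∧ m * x i ≤ v i + 1) ∧ MvPolynomial.eval x (P l) = 0 := by
    intro v hv
    obtain ⟨y, y', hyK, hyK', hy, hy'⟩ := hV v hv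
    refine exists_zero_of_mem_of_notMem P 𝒞
      (K := {x | ∀ i, (v i : ℝ) ≤ m * x i ∧ m * x i ≤ v i + 1}) ?_ hyK hyK' hy hy'
    have : {x : Fin d → ℝ | ∀ i, (v i : ℝ) ≤ m * x i ∧ m * x i ≤ v i + 1} =
        Set.univ.pi fun i => Set.Icc ((v i : ℝ) / m) ((v i + 1) / m) := by
      ext x
      simp only [Set.mem_ofPred_eq, Set.mem_univ_pi, Set.mem_Icc, div_le_iff₀ hm0,
        le_div_iff₀ hm0, mul_comm]
    rw [this]
    exact isPreconnected_univ_pi fun i => isPreconnected_Icc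
  rcases V.eq_empty_or_nonempty with rfl | ⟨v₀, hv₀⟩
  · rw [Finset.card_empty, Nat.cast_zero]
    positivity
  have hd₀ : 1 ≤ d₀ := by
    obtain ⟨l, hl, x, -, hx⟩ := hzero v₀ hv₀
    by_contra! h
    have h0 : (P l).totalDegree = 0 := by have := hdeg l; omega
    rw [MvPolynomial.totalDegree_eq_zero_iff_eq_C] at h0
    rw [h0, MvPolynomial.eval_C] at hx
    rw [h0, hx, map_zero] at hl
    exact hl rfl
  have hs : 1 ≤ s := by
    obtain ⟨l, -⟩ := hzero v₀ hv₀
    have := l.2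
    omega
  have hd₀' : (1 : ℝ) ≤ d₀ := by exact_mod_cast hd₀
  have hs' : (1 : ℝ) ≤ s := by exact_mod_cast hs
  have hsB' : (s : ℝ) ≤ B := by nlinarith
  have hdB : (d₀ : ℝ) ≤ B := by nlinarith
  let N := 4 ^ d * ((d * (2 * d₀) + 1) ^ d) ^ d * (m + 1) ^ (d - 1)
  have hcard : V.card ≤ s * N := by
    let Vl : Fin s → Finset (Fin d → ℕ) := fun l => V.filter fun v => P l ≠ 0 ∧ ∃ x : Fin d → ℝ,
      (∀ i, (v i : ℝ) ≤ m * x i ∧ m * x i ≤ v i + 1) ∧ MvPolynomial.eval x (P l) = 0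
    have hsub : V ⊆ Finset.univ.biUnion Vl := fun v hv => by
      obtain ⟨l, hl⟩ := hzero v hv
      exact Finset.mem_biUnion.2 ⟨l, Finset.mem_univ l, Finset.mem_filter.2 ⟨hv, hl⟩⟩
    refine (Finset.card_le_card hsub).trans ?_
    refine (Finset.card_biUnion_le_card_mul _ _ N fun l _ => ?_).trans (by simp)
    by_cases hl : P l = 0
    · simp [Vl, hl]
    · exact card_cubes_with_zero_le hd hl hd₀ (hdeg l) hm _
        (fun v hv => hVm v (Finset.mem_filter.1 hv).1) fun v hv => (Finset.mem_filter.1 hv).2.2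
  calc (V.card : ℝ) ≤ s * N := by exact_mod_cast hcard
    _ = s * (4 ^ d * (d * (2 * d₀) + 1) ^ (d * d) * (m + 1) ^ (d - 1)) := by
        simp only [N, pow_mul]
        push_cast
        ring
    _ ≤ B * (4 ^ d * ((2 * d + 1) * B) ^ (d * d) * (m + 1) ^ (d - 1)) := by
        have : (d : ℝ) * (2 * d₀) + 1 ≤ (2 * d + 1) * B := by
          nlinarith [Nat.cast_nonneg (α := ℝ) d]
        gcongr
    _ = _ := by
        rw [mul_pow, pow_add, pow_one]
        ring

/-- A set of small measure does not contain any grid cube. -/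
lemma exists_mem_cube_notMem {d m : ℕ} (hm : 1 ≤ m) {Ω : Set (Fin d → ℝ)} {ε : ℝ}
    (hΩ : volume Ω < ENNReal.ofReal (ε ^ d)) (hε : 0 ≤ ε) (hεm : ε * m ≤ 1) (v : Fin d → ℕ) :
    ∃ y : Fin d → ℝ, (∀ i, (v i : ℝ) ≤ m * y i ∧ m * y i ≤ v i + 1) ∧ y ∉ Ω := by
  have hm0 : (0 : ℝ) < m := by exact_mod_cast hm
  by_contra! hcon
  have hsub : (Set.univ.pi fun i => Set.Icc ((v i : ℝ) / m) ((v i + 1) / m)) ⊆ Ω := fun y hy =>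
    hcon y fun i => by
      have := hy i trivial
      rwa [Set.mem_Icc, div_le_iff₀ hm0, le_div_iff₀ hm0, mul_comm (y i)] at this
  refine (hΩ.trans_le (le_trans ?_ (measure_mono hsub))).false
  rw [volume_pi_pi]
  simp only [Real.volume_Icc, ← sub_div, add_sub_cancel_left, Finset.prod_const, Finset.card_univ,
    Fintype.card_fin]
  rw [← ENNReal.ofReal_pow (by positivity)]
  refine ENNReal.ofReal_le_ofReal (pow_le_pow_left₀ hε ?_ d)
  rwa [le_div_iff₀ hm0]

/-- orbit counting in a small semi-algebraic set `Ω ⊆ [0,1]^d ≅ 𝕋^d`: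
with `ε = L^{-1/((d+1)2^{d+1})}`, if `mes Ω < ε^d` then the number of `1 ≤ n ≤ L` with
`Tⁿx ∈ Ω` is at most `B^C ε L`. -/
theorem statement_10 (d : ℕ) (hd : 2 ≤ d) (c : ℝ) (hc : 0 < c) :
    ∃ (C : ℝ) (L₀ : ℕ), 0 < C ∧
      ∀ L : ℕ, L₀ ≤ L →
      ∀ ω : ℝ, (∀ k : ℤ, k ≠ 0 → |k| ≤ (L : ℤ) → c / (k : ℝ) ^ 2 < ‖((k * ω : ℝ) : 𝕋)‖) →
      ∀ B : ℝ, 2 ≤ B →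
      ∀ Ω : Set (Fin d → ℝ), IsSemialgebraic d B Ω →
        (∀ y ∈ Ω, ∀ i, y i ∈ Set.Icc (0 : ℝ) 1) →
        volume Ω < ENNReal.ofReal (((L : ℝ) ^ (-(1 : ℝ) / ((d + 1) * 2 ^ (d + 1)))) ^ d) →
      ∀ x : Fin d → 𝕋,
        ({n : ℕ | n ∈ Finset.Icc 1 L ∧
            (fun i => rep ((skewShift d ω)^[n] x i)) ∈ Ω}.ncard : ℝ)
          ≤ B ^ C * ((L : ℝ) ^ (-(1 : ℝ) / ((d + 1) * 2 ^ (d + 1)))) * L := by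
  classical
  obtain ⟨C₀, hC₀, hcube⟩ := exists_card_orbit_cube_le d (by omega) hc
  obtain ⟨e, he⟩ := pow_unbounded_of_one_lt
    (C₀ * (4 ^ d * (2 * d + 1) ^ (d * d)) * 2 ^ (d - 1)) (one_lt_two (α := ℝ))
  refine ⟨((e + (1 + d * d) : ℕ) : ℝ), 1, by positivity, fun L hL ω hω B hB Ω hΩ _ hvol x => ?_⟩
  set q : ℝ := ((d : ℝ) + 1) * 2 ^ (d + 1) with hq
  have hq0 : 0 < q := by positivity
  have hL1 : (1 : ℝ) ≤ L := by exact_mod_cast hL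
  have hL0 : (0 : ℝ) < L := by linarith
  set M : ℝ := (L : ℝ) ^ (1 / q) with hM
  have hM1 : 1 ≤ M := Real.one_le_rpow hL1 (by positivity)
  set m := ⌊M⌋₊ with hm_def
  have hm : 1 ≤ m := Nat.le_floor (by simpa using hM1)
  have hm' : (1 : ℝ) ≤ m := by exact_mod_cast hm
  have hmM : (m : ℝ) ≤ M := Nat.floor_le (by linarith)
  have hMm : M ≤ 2 * m := by linarith [Nat.lt_floor_add_one M]
  have hε : (L : ℝ) ^ (-(1 : ℝ) / q) = M⁻¹ := by rw [hM, neg_div, Real.rpow_neg hL0.le]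
  rw [hε] at hvol ⊢
  let S := (Finset.range L).filter fun n => (fun i => rep ((skewShift d ω)^[n + 1] x i)) ∈ Ω
  let φ : ℕ → Fin d → ℕ := fun n i => ⌊m * rep ((skewShift d ω)^[n + 1] x i)⌋₊
  have hncard : {n : ℕ | n ∈ Finset.Icc 1 L ∧
      (fun i => rep ((skewShift d ω)^[n] x i)) ∈ Ω}.ncard ≤ S.card := by
    refine le_trans ?_ (Finset.card_image_le (s := S) (f := Nat.succ))
    rw [← Set.ncard_coe_finset]
    refine Set.ncard_le_ncard ?_ (Finset.finite_toSet _)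
    rintro n ⟨hn, hnΩ⟩
    rw [Finset.mem_Icc] at hn
    obtain ⟨k, rfl⟩ : ∃ k, n = k + 1 := ⟨n - 1, by omega⟩
    exact Finset.mem_coe.2 (Finset.mem_image_of_mem _
      (Finset.mem_filter.2 ⟨Finset.mem_range.2 (by omega), hnΩ⟩))
  have hfib : (S.card : ℝ) ≤ (S.image φ).card * (C₀ * (L : ℝ) ^ (1 - d / q)) := by
    rw [Finset.card_eq_sum_card_image φ S, Nat.cast_sum, ← nsmul_eq_mul]
    refine Finset.sum_le_card_nsmul _ _ _ fun v _ => ?_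
    exact hcube L hL ω hω x m hm hmM hMm v _
      ((Finset.filter_subset _ _).trans (Finset.filter_subset _ _))
      fun n hn i => congrFun (Finset.mem_filter.1 hn).2 i
  have hcard := card_boundary_cubes_le (by omega) hΩ hm (by linarith) (S.image φ)
    (fun v hv i => by
      obtain ⟨n, -, rfl⟩ := Finset.mem_image.1 hv
      have := rep_mem_Ico ((skewShift d ω)^[n + 1] x i)
      refine (Nat.floor_lt (mul_nonneg (by positivity) this.1)).2 ?_
      nlinarith [this.2])
    (fun v hv => by
      obtain ⟨n, hn, rfl⟩ := Finset.mem_image.1 hv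
      obtain ⟨y', hy', hy'Ω⟩ := exists_mem_cube_notMem hm hvol (by positivity)
        (by rw [inv_mul_le_iff₀ (by linarith)]; linarith) (φ n)
      refine ⟨_, y', fun i => ⟨Nat.floor_le (mul_nonneg (by positivity) (rep_mem_Ico _).1),
        (Nat.lt_floor_add_one _).le⟩, hy', (Finset.mem_filter.1 hn).2, hy'Ω⟩)
  have hpow : M ^ (d - 1) * (L : ℝ) ^ (1 - d / q) = M⁻¹ * L := by
    rw [hM, ← Real.rpow_natCast, ← Real.rpow_mul hL0.le, ← Real.rpow_neg hL0.le,
      ← Real.rpow_add hL0, Nat.cast_sub (by omega)]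
    conv_rhs => rw [← Real.rpow_one (L : ℝ), ← Real.rpow_mul hL0.le, ← Real.rpow_add hL0]
    congr 1
    push_cast
    field_simp
    ring
  have hBe : (2 : ℝ) ^ e ≤ B ^ e := pow_le_pow_left₀ (by norm_num) hB e
  have hML : 0 ≤ M⁻¹ * L := by positivity
  calc _ ≤ (S.card : ℝ) := by exact_mod_cast hncard
    _ ≤ (4 ^ d * (2 * d + 1) ^ (d * d) * B ^ (1 + d * d) * (m + 1) ^ (d - 1)) *
        (C₀ * (L : ℝ) ^ (1 - d / q)) := hfib.trans (by gcongr)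
    _ ≤ (4 ^ d * (2 * d + 1) ^ (d * d) * B ^ (1 + d * d) * (2 * M) ^ (d - 1)) *
        (C₀ * (L : ℝ) ^ (1 - d / q)) := by
        have : (m : ℝ) + 1 ≤ 2 * M := by linarith
        gcongr
    _ = (C₀ * (4 ^ d * (2 * d + 1) ^ (d * d)) * 2 ^ (d - 1)) * B ^ (1 + d * d) *
        (M ^ (d - 1) * (L : ℝ) ^ (1 - d / q)) := by
        rw [mul_pow 2 M]
        ring
    _ ≤ B ^ e * B ^ (1 + d * d) * (M⁻¹ * L) := by
        rw [hpow]
        gcongr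
        exact he.le.trans hBe
    _ = _ := by rw [Real.rpow_natCast, pow_add B e, mul_assoc _ M⁻¹]
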